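/- Let M be an endotrivial V(a_r)-supermodule, where a_r is a rank r detecting subalgebra. Then M ≅ Ω^n(k) ⊕ P for some integer n, where k is either the trivial module k_ev or its parity shift k_od, and P is a projective module in F. -/

import Mathlib

/-!
A concrete model of the supermodule categories of the paper "On Endotrivial
Modules for Lie Superalgebras" attached to the detecting subalgebras
`e_r = q(1)^{×r}`, `f_n = sl(1|1)^{×n}`, to rank-one subalgebras `⟨z⟩` of
`sl(1|1)`, and to the exterior superalgebras `V(a_r) = Λ((a_r)₁)`.

A `GSupMod k ι` is a finite-dimensional `ℤ₂`-graded `k`-vector space together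
with a family of odd operators `θ i` (the actions of the distinguished odd
basis elements of the superalgebra: the `e_i` for `e_r`, the `x_i, y_i` for
`f_n`, the `a_i` for `V(a_r)`).  The even parts of all these superalgebras are
generated by the brackets of the odd generators, so the relations defining
each particular category, as well as complete reducibility over the even part,
are imposed by a predicate `𝒞 : GSupMod k ι → Prop`, defined separately for
each case.  All categorical notions (homomorphisms, isomorphisms, direct sums,
tensor products, duals, internal Hom, trivial modules, projectivity,
projective covers and injective hulls, syzygies `Ωⁿ` for `n : ℤ`, endotrivial
modules, and the group `T` of stable classes of endotrivial modules) are
defined relative to such a predicate.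
-/

noncomputable section

namespace SupCat

open Submodule

/-- A finite-dimensional `ℤ₂`-graded `k`-vector space with a family of odd
operators `θ i`, indexed by `ι` (the underlying data of a supermodule over a
superalgebra whose odd part has a distinguished basis indexed by `ι`). -/
structure GSupMod (k : Type) [Field k] (ι : Type) : Type 1 where
  carrier : Type
  [isAddCommGroup : AddCommGroup carrier]
  [isModule : Module k carrier]
  [isFinite : FiniteDimensional k carrier]
  /-- the even component -/
  ev : Submodule k carrier
  /-- the odd component -/
  od : Submodule k carrier
  isCompl : IsCompl ev od
  /-- the (odd) actions of the distinguished odd basis elements -/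
  θ : ι → (carrier →ₗ[k] carrier)
  θ_ev : ∀ i, ∀ m ∈ ev, θ i m ∈ od
  θ_od : ∀ i, ∀ m ∈ od, θ i m ∈ ev

attribute [instance] GSupMod.isAddCommGroup GSupMod.isModule GSupMod.isFinite

namespace GSupMod

variable {k : Type} [Field k] {ι : Type}

/-- The action of a general odd element `v = ∑ v i • (basis element i)`. -/
def actOf [Fintype ι] (M : GSupMod k ι) (v : ι → k) : M.carrier →ₗ[k] M.carrier :=
  ∑ i, v i • M.θ i

/-- The grading involution `σ` of a supermodule: `+1` on the even part and
`-1` on the odd part. -/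
def sigma (M : GSupMod k ι) : M.carrier →ₗ[k] M.carrier :=
  M.ev.subtype ∘ₗ Submodule.linearProjOfIsCompl M.ev M.od M.isCompl
    - M.od.subtype ∘ₗ Submodule.linearProjOfIsCompl M.od M.ev M.isCompl.symm

/-- `f` is a homomorphism of supermodules (an equivariant linear map of
degree `0̄`). -/
def IsHom (M N : GSupMod k ι) (f : M.carrier →ₗ[k] N.carrier) : Prop :=
  (∀ i, f ∘ₗ M.θ i = N.θ i ∘ₗ f) ∧
  (∀ m ∈ M.ev, f m ∈ N.ev) ∧ (∀ m ∈ M.od, f m ∈ N.od)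

/-- `M ≅ N` as supermodules. -/
def Iso (M N : GSupMod k ι) : Prop :=
  ∃ e : M.carrier ≃ₗ[k] N.carrier, IsHom M N (e : M.carrier →ₗ[k] N.carrier)

/-- `S` is (isomorphic to) the direct sum `A ⊕ B`. -/
def IsDsum (A B S : GSupMod k ι) : Prop :=
  ∃ φ : S.carrier ≃ₗ[k] A.carrier × B.carrier,
    (∀ s, s ∈ S.ev ↔ (φ s).1 ∈ A.ev ∧ (φ s).2 ∈ B.ev) ∧
    (∀ s, s ∈ S.od ↔ (φ s).1 ∈ A.od ∧ (φ s).2 ∈ B.od) ∧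
    ∀ (i : ι) (s : S.carrier),
      φ (S.θ i s) = LinearMap.prodMap (A.θ i) (B.θ i) (φ s)

/-- `M` is (isomorphic to) the trivial supermodule of parity `p`: `k_ev`
for `p = false`, and `k_od = Π(k_ev)` for `p = true`. -/
def IsTrivial (p : Bool) (M : GSupMod k ι) : Prop :=
  Module.finrank k M.carrier = 1 ∧ (∀ i, M.θ i = 0) ∧
    (if p then M.od = ⊤ else M.ev = ⊤)

/-- `M` is indecomposable. -/
def Indecomposable (M : GSupMod k ι) : Prop :=
  (∃ m : M.carrier, m ≠ 0) ∧
  ∀ A B : GSupMod k ι, IsDsum A B M →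
    (∀ a : A.carrier, a = 0) ∨ (∀ b : B.carrier, b = 0)

/-- `M` is a simple supermodule: nonzero, with no proper nonzero graded
invariant submodule. -/
def IsSimple (M : GSupMod k ι) : Prop :=
  (∃ m : M.carrier, m ≠ 0) ∧
  ∀ N : Submodule k M.carrier,
    (∀ i, ∀ m ∈ N, M.θ i m ∈ N) →
    N = (N ⊓ M.ev) ⊔ (N ⊓ M.od) →
    N = ⊥ ∨ N = ⊤

variable (𝒞 : GSupMod k ι → Prop)

/-- `P` is a projective object of the category cut out by `𝒞` (defined by the
lifting property). -/
def IsProjective (P : GSupMod k ι) : Prop :=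
  𝒞 P ∧
  ∀ (M N : GSupMod k ι) (π : M.carrier →ₗ[k] N.carrier)
    (f : P.carrier →ₗ[k] N.carrier),
    𝒞 M → 𝒞 N → IsHom M N π → Function.Surjective π → IsHom P N f →
    ∃ h : P.carrier →ₗ[k] M.carrier, IsHom P M h ∧ π ∘ₗ h = f

/-- `I` is an injective object of the category cut out by `𝒞`. -/
def IsInjective (I : GSupMod k ι) : Prop :=
  𝒞 I ∧
  ∀ (M N : GSupMod k ι) (j : M.carrier →ₗ[k] N.carrier)
    (f : M.carrier →ₗ[k] I.carrier),
    𝒞 M → 𝒞 N → IsHom M N j → Function.Injective j → IsHom M I f →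
    ∃ h : N.carrier →ₗ[k] I.carrier, IsHom N I h ∧ h ∘ₗ j = f

/-- `π : P ↠ M` is a projective cover. -/
def IsProjCover (P M : GSupMod k ι) (π : P.carrier →ₗ[k] M.carrier) : Prop :=
  IsProjective 𝒞 P ∧ IsHom P M π ∧ Function.Surjective π ∧
  ∀ (Q : GSupMod k ι) (f : Q.carrier →ₗ[k] P.carrier),
    𝒞 Q → IsHom Q P f → Function.Surjective (π ∘ₗ f) → Function.Surjective f

/-- `j : M ↪ I` is an injective hull. -/
def IsInjHull (M I : GSupMod k ι) (j : M.carrier →ₗ[k] I.carrier) : Prop :=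
  IsInjective 𝒞 I ∧ IsHom M I j ∧ Function.Injective j ∧
  ∀ (Q : GSupMod k ι) (f : I.carrier →ₗ[k] Q.carrier),
    𝒞 Q → IsHom I Q f → Function.Injective (f ∘ₗ j) → Function.Injective f

/-- `N` is (isomorphic to) the first syzygy `Ω¹(M)`, the kernel of a
projective cover of `M`. -/
def IsSyzygy (M N : GSupMod k ι) : Prop :=
  𝒞 N ∧
  ∃ (P : GSupMod k ι) (π : P.carrier →ₗ[k] M.carrier)
    (i : N.carrier →ₗ[k] P.carrier),
    IsProjCover 𝒞 P M π ∧ IsHom N P i ∧ Function.Injective i ∧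
    LinearMap.range i = LinearMap.ker π

/-- `N` is (isomorphic to) the first cosyzygy `Ω⁻¹(M)`, the cokernel of the
inclusion of `M` into its injective hull. -/
def IsCosyzygy (M N : GSupMod k ι) : Prop :=
  𝒞 N ∧
  ∃ (I : GSupMod k ι) (j : M.carrier →ₗ[k] I.carrier)
    (p : I.carrier →ₗ[k] N.carrier),
    IsInjHull 𝒞 M I j ∧ IsHom I N p ∧ Function.Surjective p ∧
    LinearMap.ker p = LinearMap.range j

/-- `M` has no nonzero projective direct summand (equivalently, since the
category is self-injective, no nonzero projective submodule). -/
def NoProjSummands (M : GSupMod k ι) : Prop :=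
  ∀ A B : GSupMod k ι, IsProjective 𝒞 A → IsDsum A B M → ∀ a : A.carrier, a = 0

/-- `N` is (isomorphic to) `Ω⁰(M)`, the complement of the largest projective
direct summand of `M`. -/
def IsOmegaZero (M N : GSupMod k ι) : Prop :=
  ∃ Q : GSupMod k ι, IsProjective 𝒞 Q ∧ NoProjSummands 𝒞 N ∧ IsDsum N Q M

/-- `N` is (isomorphic to) `Ωⁿ(M)` for `n ∈ ℕ`. -/
def IsOmegaPow : ℕ → GSupMod k ι → GSupMod k ι → Prop
  | 0, M, N => IsOmegaZero 𝒞 M N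
  | n+1, M, N => ∃ L, IsOmegaPow n M L ∧ IsSyzygy 𝒞 L N

/-- `N` is (isomorphic to) `Ω⁻ⁿ(M)` for `n ∈ ℕ`. -/
def IsOmegaNegPow : ℕ → GSupMod k ι → GSupMod k ι → Prop
  | 0, M, N => IsOmegaZero 𝒞 M N
  | n+1, M, N => ∃ L, IsOmegaNegPow n M L ∧ IsCosyzygy 𝒞 L N

/-- `N` is (isomorphic to) the syzygy `Ωⁿ(M)`, for any `n : ℤ`. -/
def IsOmega (n : ℤ) (M N : GSupMod k ι) : Prop :=
  if 0 ≤ n then IsOmegaPow 𝒞 n.toNat M N else IsOmegaNegPow 𝒞 (-n).toNat M N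

/-- `H` is (isomorphic to) the internal Hom supermodule `Hom_k(M,N)` with its
usual grading and the super action of the odd generators
`(θ i · f)(m) = θ i (f m) - (-1)^{|f|} f (θ i m)` (the sign `(-1)^{|f|}` is
expressed via the grading involutions `σ`). -/
def IsHomObj (M N H : GSupMod k ι) : Prop :=
  ∃ φ : H.carrier ≃ₗ[k] (M.carrier →ₗ[k] N.carrier),
    (∀ h, h ∈ H.ev ↔ ((∀ m ∈ M.ev, φ h m ∈ N.ev) ∧ (∀ m ∈ M.od, φ h m ∈ N.od))) ∧
    (∀ h, h ∈ H.od ↔ ((∀ m ∈ M.ev, φ h m ∈ N.od) ∧ (∀ m ∈ M.od, φ h m ∈ N.ev))) ∧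
    ∀ (i : ι) (h : H.carrier),
      φ (H.θ i h) = N.θ i ∘ₗ φ h - (N.sigma ∘ₗ φ h ∘ₗ M.sigma) ∘ₗ M.θ i

/-- `T` is (isomorphic to) the tensor product supermodule `M ⊗_k N` with its
usual grading and the action of the odd generators
`θ i · (m ⊗ n) = (θ i m) ⊗ n + (-1)^{|m|} m ⊗ (θ i n)`. -/
def IsTensorObj (M N T : GSupMod k ι) : Prop :=
  ∃ φ : T.carrier ≃ₗ[k] TensorProduct k M.carrier N.carrier,
    Submodule.map (φ : T.carrier →ₗ[k] TensorProduct k M.carrier N.carrier) T.ev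
      = Submodule.span k
          ({z | ∃ m ∈ M.ev, ∃ n ∈ N.ev, z = m ⊗ₜ[k] n}
            ∪ {z | ∃ m ∈ M.od, ∃ n ∈ N.od, z = m ⊗ₜ[k] n}) ∧
    Submodule.map (φ : T.carrier →ₗ[k] TensorProduct k M.carrier N.carrier) T.od
      = Submodule.span k
          ({z | ∃ m ∈ M.ev, ∃ n ∈ N.od, z = m ⊗ₜ[k] n}
            ∪ {z | ∃ m ∈ M.od, ∃ n ∈ N.ev, z = m ⊗ₜ[k] n}) ∧
    ∀ (i : ι) (t : T.carrier),
      φ (T.θ i t)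
        = TensorProduct.map (M.θ i) (LinearMap.id : N.carrier →ₗ[k] N.carrier) (φ t)
            + TensorProduct.map M.sigma (N.θ i) (φ t)

/-- `D` is (isomorphic to) the dual supermodule `M* = Hom_k(M, k_ev)`, with
the action `(θ i · ψ)(m) = -(-1)^{|ψ|} ψ (θ i m)`. -/
def IsDualObj (M D : GSupMod k ι) : Prop :=
  ∃ φ : D.carrier ≃ₗ[k] Module.Dual k M.carrier,
    (∀ d, d ∈ D.ev ↔ ∀ m ∈ M.od, φ d m = 0) ∧
    (∀ d, d ∈ D.od ↔ ∀ m ∈ M.ev, φ d m = 0) ∧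
    ∀ (i : ι) (d : D.carrier),
      φ (D.θ i d) = - (φ d) ∘ₗ (M.sigma ∘ₗ M.θ i)

/-- `M` is an endotrivial supermodule of the category cut out by `𝒞`:
`Hom_k(M,M) ≅ k_ev ⊕ P` with `P` projective. -/
def IsEndotrivial (M : GSupMod k ι) : Prop :=
  𝒞 M ∧
  ∃ H K P S : GSupMod k ι, IsHomObj M M H ∧ 𝒞 H ∧ IsTrivial false K ∧
    IsProjective 𝒞 P ∧ IsDsum K P S ∧ Iso H S

/-- `M` and `N` are isomorphic in the stable module category: they become
isomorphic after adding projective direct summands. -/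
def StIso (M N : GSupMod k ι) : Prop :=
  ∃ P Q S T : GSupMod k ι, IsProjective 𝒞 P ∧ IsProjective 𝒞 Q ∧
    IsDsum M P S ∧ IsDsum N Q T ∧ Iso S T

/-- `R` is (isomorphic to) the restriction of `M` along the subalgebra of the
odd space spanned by the vectors `ε j`: the same underlying graded vector
space, where the `j`-th odd generator acts as the element `ε j` did on `M`. -/
def IsRestriction {ι' : Type} [Fintype ι] (ε : ι' → ι → k)
    (M : GSupMod k ι) (R : GSupMod k ι') : Prop :=
  ∃ φ : R.carrier ≃ₗ[k] M.carrier,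
    (∀ m, m ∈ R.ev ↔ φ m ∈ M.ev) ∧
    (∀ m, m ∈ R.od ↔ φ m ∈ M.od) ∧
    ∀ (j : ι') (m : R.carrier), φ (R.θ j m) = actOf M (ε j) (φ m)

/-- The radical `Rad(M)` of a supermodule over one of the detecting
superalgebras on the principal block: the span of the images of the odd
generators. -/
def radical (M : GSupMod k ι) : Submodule k M.carrier :=
  ⨆ i, LinearMap.range (M.θ i)

/-- The rank `Rk(M) = dim_k (M / Rad M)`. -/
def rk (M : GSupMod k ι) : ℕ :=
  Module.finrank k (M.carrier ⧸ radical M)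

end GSupMod

open GSupMod

variable {k : Type} [Field k]

/-- The category of supermodules (in the principal block) over the exterior
superalgebra `V(a_r) = Λ((a_r)₁)` on the purely odd abelian `r`-dimensional
space `(a_r)₁`: the odd generators pairwise super-anticommute (in particular
they square to zero).  Complete reducibility over the even part is automatic
since the even part acts by zero. -/
def VCat (k : Type) [Field k] (r : ℕ) : GSupMod k (Fin r) → Prop :=
  fun M => ∀ i j, M.θ i ∘ₗ M.θ j + M.θ j ∘ₗ M.θ i = 0

/-- The relation on endotrivial supermodules inducing the group `T`: stable
isomorphism. -/
def TRel {ι : Type} (𝒞 : GSupMod k ι → Prop) :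
    {M : GSupMod k ι // IsEndotrivial 𝒞 M} →
    {M : GSupMod k ι // IsEndotrivial 𝒞 M} → Prop :=
  fun M N => StIso 𝒞 M.1 N.1

/-- The underlying set of the group `T`: stable isomorphism classes of
endotrivial supermodules. -/
def TGrp {ι : Type} (𝒞 : GSupMod k ι → Prop) : Type 1 := Quot (TRel 𝒞)

/-- The stable class of an endotrivial supermodule. -/
def tmk {ι : Type} (𝒞 : GSupMod k ι → Prop)
    (M : {M : GSupMod k ι // IsEndotrivial 𝒞 M}) : TGrp 𝒞 :=
  Quot.mk (TRel 𝒞) M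

/-- An abelian group structure on `T` whose multiplication, identity and
inverse are induced by tensor product, the trivial module `k_ev` and duality
respectively. -/
structure TGroupData {ι : Type} (𝒞 : GSupMod k ι → Prop) : Type 1 where
  mul : TGrp 𝒞 → TGrp 𝒞 → TGrp 𝒞
  one : TGrp 𝒞
  inv : TGrp 𝒞 → TGrp 𝒞
  mul_assoc : ∀ a b c, mul (mul a b) c = mul a (mul b c)
  mul_comm : ∀ a b, mul a b = mul b a
  one_mul : ∀ a, mul one a = a
  inv_mul : ∀ a, mul (inv a) a = one
  mul_spec : ∀ (M N : {M : GSupMod k ι // IsEndotrivial 𝒞 M}) (T : GSupMod k ι)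
      (_ : IsTensorObj M.1 N.1 T) (hT : IsEndotrivial 𝒞 T),
      mul (tmk 𝒞 M) (tmk 𝒞 N) = tmk 𝒞 ⟨T, hT⟩
  one_spec : ∀ (K : GSupMod k ι) (_ : IsTrivial false K) (hK : IsEndotrivial 𝒞 K),
      one = tmk 𝒞 ⟨K, hK⟩
  inv_spec : ∀ (M : {M : GSupMod k ι // IsEndotrivial 𝒞 M}) (D : GSupMod k ι)
      (_ : IsDualObj M.1 D) (hD : IsEndotrivial 𝒞 D),
      inv (tmk 𝒞 M) = tmk 𝒞 ⟨D, hD⟩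

end SupCat

noncomputable section
set_option linter.unusedSectionVars false
set_option linter.deprecated false
namespace SupCat.EP
open SupCat SupCat.GSupMod

variable {k : Type} [Field k]

section basics
variable {ι : Type}

lemma sigma_ev (M : GSupMod k ι) {x : M.carrier} (hx : x ∈ M.ev) : M.sigma x = x := by
  simp only [GSupMod.sigma, Submodule.linearProjOfIsCompl, LinearMap.sub_apply, LinearMap.comp_apply, Submodule.subtype_apply]
  erw [Submodule.projectionOnto_apply_left M.isCompl ⟨x, hx⟩,
    (Submodule.projectionOnto_apply_eq_zero_iff M.isCompl.symm).2 hx]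
  simp

lemma sigma_od (M : GSupMod k ι) {x : M.carrier} (hx : x ∈ M.od) : M.sigma x = -x := by
  simp only [GSupMod.sigma, Submodule.linearProjOfIsCompl, LinearMap.sub_apply, LinearMap.comp_apply, Submodule.subtype_apply]
  erw [Submodule.projectionOnto_apply_left M.isCompl.symm ⟨x, hx⟩,
    (Submodule.projectionOnto_apply_eq_zero_iff M.isCompl).2 hx]
  simp

lemma decomp (M : GSupMod k ι) (x : M.carrier) : ∃ y ∈ M.ev, ∃ z ∈ M.od, x = y + z := by
  have : x ∈ M.ev ⊔ M.od := by rw [M.isCompl.sup_eq_top]; trivial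
  obtain ⟨y, hy, z, hz, h⟩ := Submodule.mem_sup.1 this
  exact ⟨y, hy, z, hz, h.symm⟩

lemma sigma_sigma (M : GSupMod k ι) (x : M.carrier) : M.sigma (M.sigma x) = x := by
  obtain ⟨y, hy, z, hz, rfl⟩ := decomp M x
  simp [sigma_ev M hy, sigma_od M hz]

lemma sigma_θ (M : GSupMod k ι) (i : ι) (x : M.carrier) :
    M.sigma (M.θ i x) = - M.θ i (M.sigma x) := by
  obtain ⟨y, hy, z, hz, rfl⟩ := decomp M x
  simp [sigma_ev M hy, sigma_od M hz, sigma_od M (M.θ_ev i y hy), sigma_ev M (M.θ_od i z hz)]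
  abel

variable [CharZero k]

lemma self_eq_neg_k {V : Type} [AddCommGroup V] [Module k V] {x : V} (h : x = -x) : x = 0 := by
  have h2 : (2 : k) • x = 0 := by
    rw [two_smul]; nth_rewrite 2 [h]; simp
  exact (smul_eq_zero.1 h2).resolve_left two_ne_zero

lemma mem_ev_iff (M : GSupMod k ι) (x : M.carrier) : x ∈ M.ev ↔ M.sigma x = x := by
  refine ⟨sigma_ev M, fun h => ?_⟩
  obtain ⟨y, hy, z, hz, rfl⟩ := decomp M x
  have : z = -z := by
    have := h; simp only [map_add, sigma_ev M hy, sigma_od M hz] at this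
    exact (add_left_cancel this).symm
  rw [self_eq_neg_k (k := k) this]; simpa using hy

lemma mem_od_iff (M : GSupMod k ι) (x : M.carrier) : x ∈ M.od ↔ M.sigma x = -x := by
  refine ⟨sigma_od M, fun h => ?_⟩
  obtain ⟨y, hy, z, hz, rfl⟩ := decomp M x
  have : y = -y := by
    have := h; simp only [map_add, sigma_ev M hy, sigma_od M hz, neg_add] at this
    exact (add_right_cancel this)
  rw [self_eq_neg_k (k := k) this]; simpa using hz

lemma isHom_iff (M N : GSupMod k ι) (f : M.carrier →ₗ[k] N.carrier) :
    IsHom M N f ↔ (∀ i x, f (M.θ i x) = N.θ i (f x)) ∧ ∀ x, f (M.sigma x) = N.sigma (f x) := by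
  constructor
  · rintro ⟨h1, h2, h3⟩
    refine ⟨fun i x => LinearMap.congr_fun (h1 i) x, fun x => ?_⟩
    obtain ⟨y, hy, z, hz, rfl⟩ := decomp M x
    simp [sigma_ev M hy, sigma_od M hz, sigma_ev N (h2 y hy), sigma_od N (h3 z hz)]
  · rintro ⟨h1, h2⟩
    refine ⟨fun i => LinearMap.ext (h1 i), fun m hm => ?_, fun m hm => ?_⟩
    · rw [mem_ev_iff, ← h2, sigma_ev M hm]
    · rw [mem_od_iff, ← h2, sigma_od M hm, map_neg]

/-- build a supermodule from a grading involution -/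
abbrev mkS (V : Type) [AddCommGroup V] [Module k V] [FiniteDimensional k V] (s : V →ₗ[k] V)
    (hs : ∀ x, s (s x) = x) (θ : ι → (V →ₗ[k] V)) (hθ : ∀ i x, s (θ i x) = - θ i (s x)) :
    GSupMod k ι where
  carrier := V
  ev := LinearMap.ker (s - LinearMap.id)
  od := LinearMap.ker (s + LinearMap.id)
  isCompl := by
    constructor
    · rw [Submodule.disjoint_def]
      intro x h1 h2
      simp only [LinearMap.mem_ker, LinearMap.sub_apply, LinearMap.add_apply, LinearMap.id_apply] at h1 h2
      have h1 := sub_eq_zero.1 h1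
      rw [h1] at h2
      exact self_eq_neg_k (k := k) (eq_neg_of_add_eq_zero_left h2)
    · rw [codisjoint_iff, eq_top_iff]
      rintro x -
      refine Submodule.mem_sup.2 ⟨(2⁻¹ : k) • (x + s x), ?_, (2⁻¹ : k) • (x - s x), ?_, ?_⟩
      · simp [hs]; abel
      · simp [hs]
      · rw [← smul_add, add_add_sub_cancel, ← two_smul k x, smul_smul]; simp
  θ := θ
  θ_ev := by
    intro i m hm
    simp only [LinearMap.mem_ker, LinearMap.sub_apply, LinearMap.add_apply, LinearMap.id_apply] at *
    rw [hθ, sub_eq_zero.1 hm]; simp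
  θ_od := by
    intro i m hm
    simp only [LinearMap.mem_ker, LinearMap.sub_apply, LinearMap.add_apply, LinearMap.id_apply] at *
    rw [hθ, eq_neg_of_add_eq_zero_left hm]; simp

lemma exists_mkS (V : Type) [AddCommGroup V] [Module k V] [FiniteDimensional k V] (s : V →ₗ[k] V)
    (hs : ∀ x, s (s x) = x) (θ : ι → (V →ₗ[k] V)) (hθ : ∀ i x, s (θ i x) = - θ i (s x)) :
    ∃ (A : GSupMod k ι) (e : V ≃ₗ[k] A.carrier), (∀ i x, A.θ i (e x) = e (θ i x)) ∧
      ∀ x, A.sigma (e x) = e (s x) := by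
  let A := mkS V s hs θ hθ
  let e : V ≃ₗ[k] A.carrier := LinearEquiv.refl k V
  have he : ∀ x, x ∈ A.ev ↔ s (e.symm x) - e.symm x = 0 := fun x => Iff.rfl
  have ho : ∀ x, x ∈ A.od ↔ s (e.symm x) + e.symm x = 0 := fun x => Iff.rfl
  refine ⟨A, e, fun i x => rfl, fun x => ?_⟩
  obtain ⟨y, hy, z, hz, hx⟩ := decomp A (e x)
  have h1 := sigma_ev _ hy
  have h2 := sigma_od _ hz
  rw [hx, map_add, h1, h2]
  rw [he] at hy
  rw [ho] at hz
  have : x = e.symm y + e.symm z := by rw [← map_add, ← hx]; simp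
  rw [this, map_add, sub_eq_zero.1 hy, eq_neg_of_add_eq_zero_left hz]
  simp

/-- subobject on an invariant submodule -/
lemma exists_sub (M : GSupMod k ι) (N : Submodule k M.carrier) (h1 : ∀ i, ∀ x ∈ N, M.θ i x ∈ N)
    (h2 : ∀ x ∈ N, M.sigma x ∈ N) : ∃ (A : GSupMod k ι) (f : A.carrier →ₗ[k] M.carrier),
      IsHom A M f ∧ Function.Injective f ∧ LinearMap.range f = N := by
  obtain ⟨A, e, h3, h4⟩ := exists_mkS N (M.sigma.restrict h2) (fun x => Subtype.ext (sigma_sigma M x))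
    (fun i => (M.θ i).restrict (h1 i)) (fun i x => Subtype.ext (sigma_θ M i x))
  refine ⟨A, N.subtype ∘ₗ e.symm.toLinearMap, ?_, ?_, ?_⟩
  · rw [isHom_iff]
    refine ⟨fun i x => ?_, fun x => ?_⟩
    · obtain ⟨x, rfl⟩ := e.surjective x
      simp [h3]
    · obtain ⟨x, rfl⟩ := e.surjective x
      simp [h4]
  · exact N.subtype_injective.comp e.symm.injective
  · rw [LinearMap.range_comp]; simp

/-- quotient object -/
lemma exists_quot (M : GSupMod k ι) (N : Submodule k M.carrier) (h1 : ∀ i, ∀ x ∈ N, M.θ i x ∈ N)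
    (h2 : ∀ x ∈ N, M.sigma x ∈ N) : ∃ (A : GSupMod k ι) (f : M.carrier →ₗ[k] A.carrier),
      IsHom M A f ∧ Function.Surjective f ∧ LinearMap.ker f = N := by
  obtain ⟨A, e, h3, h4⟩ := exists_mkS (M.carrier ⧸ N) (N.mapQ N M.sigma h2)
    (fun x => by
      obtain ⟨x, rfl⟩ := Submodule.Quotient.mk_surjective N x
      simp [sigma_sigma])
    (fun i => N.mapQ N (M.θ i) (h1 i))
    (fun i x => by
      obtain ⟨x, rfl⟩ := Submodule.Quotient.mk_surjective N x
      simp [sigma_θ])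
  refine ⟨A, e.toLinearMap ∘ₗ N.mkQ, ?_, ?_, ?_⟩
  · rw [isHom_iff]
    refine ⟨fun i x => ?_, fun x => ?_⟩
    · simp [h3]
    · simp [h4]
  · exact e.surjective.comp N.mkQ_surjective
  · rw [LinearMap.ker_comp]; simp

/-- corestriction of a hom to a subobject -/
lemma exists_corestrict {A B M : GSupMod k ι} {i : A.carrier →ₗ[k] M.carrier} (hi : IsHom A M i)
    (hinj : Function.Injective i) {f : B.carrier →ₗ[k] M.carrier} (hf : IsHom B M f)
    (h : ∀ x, f x ∈ LinearMap.range i) : ∃ g : B.carrier →ₗ[k] A.carrier, IsHom B A g ∧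
      ∀ x, i (g x) = f x := by
  let e := LinearEquiv.ofInjective i hinj
  let g : B.carrier →ₗ[k] A.carrier := e.symm.toLinearMap ∘ₗ f.codRestrict _ h
  have hg : ∀ x, i (g x) = f x := by
    intro x
    have : (e (e.symm (f.codRestrict _ h x)) : M.carrier) = f x := by simp
    exact this
  refine ⟨g, ?_, hg⟩
  rw [isHom_iff] at *
  refine ⟨fun j x => hinj ?_, fun x => hinj ?_⟩
  · rw [hg, hf.1, hi.1, hg]
  · rw [hg, hf.2, hi.2, hg]

/-- descent of a hom to a quotient object -/
lemma exists_descend {A B M : GSupMod k ι} {p : M.carrier →ₗ[k] A.carrier} (hp : IsHom M A p)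
    (hsurj : Function.Surjective p) {f : M.carrier →ₗ[k] B.carrier} (hf : IsHom M B f)
    (h : ∀ x, p x = 0 → f x = 0) : ∃ g : A.carrier →ₗ[k] B.carrier, IsHom A B g ∧
      ∀ x, g (p x) = f x := by
  obtain ⟨s, hs⟩ := p.exists_rightInverse_of_surjective (LinearMap.range_eq_top.2 hsurj)
  have hs' : ∀ x, p (s x) = x := fun x => LinearMap.congr_fun hs x
  have hg : ∀ x, f (s (p x)) = f x := by
    intro x
    have := h (s (p x) - x) (by rw [map_sub, hs', sub_self])
    rwa [map_sub, sub_eq_zero] at this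
  refine ⟨f ∘ₗ s, ?_, hg⟩
  rw [isHom_iff] at *
  refine ⟨fun j x => ?_, fun x => ?_⟩
  · obtain ⟨x, rfl⟩ := hsurj x
    rw [← hp.1]; simp only [LinearMap.comp_apply, hg, hf.1]
  · obtain ⟨x, rfl⟩ := hsurj x
    rw [← hp.2]; simp only [LinearMap.comp_apply, hg, hf.2]

lemma isHom_comp {A B C : GSupMod k ι} {f : A.carrier →ₗ[k] B.carrier} {g : B.carrier →ₗ[k] C.carrier}
    (hg : IsHom B C g) (hf : IsHom A B f) : IsHom A C (g ∘ₗ f) := by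
  rw [isHom_iff] at *
  exact ⟨fun i x => by simp [hf.1, hg.1], fun x => by simp [hf.2, hg.2]⟩

lemma isHom_id (A : GSupMod k ι) : IsHom A A LinearMap.id := by
  rw [isHom_iff]; exact ⟨fun _ _ => rfl, fun _ => rfl⟩

/-- a direct sum from biproduct maps -/
lemma isDsum_of_maps {A B S : GSupMod k ι} {iA : A.carrier →ₗ[k] S.carrier}
    {iB : B.carrier →ₗ[k] S.carrier}
    (hA : IsHom A S iA) (hB : IsHom B S iB) (injA : Function.Injective iA)
    (injB : Function.Injective iB) (hc : IsCompl (LinearMap.range iA) (LinearMap.range iB)) :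
    IsDsum A B S := by
  rw [isHom_iff] at hA hB
  let ψ : (A.carrier × B.carrier) →ₗ[k] S.carrier := iA.coprod iB
  have hψ : Function.Bijective ψ := by
    constructor
    · rw [← LinearMap.ker_eq_bot, LinearMap.ker_eq_bot']
      rintro ⟨a, b⟩ h
      have h1 : iA a + iB b = 0 := by simpa [ψ] using h
      have h2 : iA a = 0 := by
        refine (Submodule.disjoint_def.1 hc.disjoint) _ ⟨a, rfl⟩ ⟨-b, ?_⟩
        rw [map_neg, eq_neg_of_add_eq_zero_left h1]
      have h3 : iB b = 0 := by rwa [h2, zero_add] at h1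
      rw [injA (h2.trans (map_zero _).symm), injB (h3.trans (map_zero _).symm)]; rfl
    · rw [← LinearMap.range_eq_top, LinearMap.range_coprod, hc.sup_eq_top]
  let φ := (LinearEquiv.ofBijective ψ hψ)
  have key : ∀ a b, φ (a, b) = iA a + iB b := fun a b => by simp [φ, ψ]
  have hs : ∀ z, φ.symm (S.sigma z) = (A.sigma (φ.symm z).1, B.sigma (φ.symm z).2) := by
    intro z
    rw [LinearEquiv.symm_apply_eq, key]
    obtain ⟨⟨a, b⟩, rfl⟩ := φ.surjective z
    rw [LinearEquiv.symm_apply_apply, key, map_add, hA.2, hB.2]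
  refine ⟨φ.symm, fun s => ?_, fun s => ?_, fun i s => ?_⟩
  · rw [mem_ev_iff, mem_ev_iff, mem_ev_iff, ← φ.symm.injective.eq_iff, hs, Prod.ext_iff]
  · rw [mem_od_iff, mem_od_iff, mem_od_iff, ← φ.symm.injective.eq_iff, hs, Prod.ext_iff]
    rw [map_neg]; rfl
  · rw [LinearEquiv.symm_apply_eq]
    obtain ⟨⟨a, b⟩, rfl⟩ := φ.surjective s
    rw [LinearEquiv.symm_apply_apply, key, map_add, LinearMap.prodMap_apply, key, hA.1, hB.1]

/-- biproduct maps out of `IsDsum` -/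
lemma isDsum_maps {A B S : GSupMod k ι} (h : IsDsum A B S) :
    ∃ (iA : A.carrier →ₗ[k] S.carrier) (iB : B.carrier →ₗ[k] S.carrier)
      (pA : S.carrier →ₗ[k] A.carrier) (pB : S.carrier →ₗ[k] B.carrier),
      IsHom A S iA ∧ IsHom B S iB ∧ IsHom S A pA ∧ IsHom S B pB ∧
      (∀ a, pA (iA a) = a) ∧ (∀ b, pB (iB b) = b) ∧ (∀ a, pB (iA a) = 0) ∧ (∀ b, pA (iB b) = 0) ∧
      (∀ s, iA (pA s) + iB (pB s) = s) := by
  obtain ⟨φ, h1, h2, h3⟩ := h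
  have hθ : ∀ i z, φ.symm (A.θ i z.1, B.θ i z.2) = S.θ i (φ.symm z) := by
    intro i z
    rw [LinearEquiv.symm_apply_eq, h3]; simp [LinearMap.prodMap]
  refine ⟨φ.symm.toLinearMap ∘ₗ LinearMap.inl k _ _, φ.symm.toLinearMap ∘ₗ LinearMap.inr k _ _,
    LinearMap.fst k _ _ ∘ₗ φ.toLinearMap, LinearMap.snd k _ _ ∘ₗ φ.toLinearMap,
    ⟨fun i => ?_, fun m hm => ?_, fun m hm => ?_⟩, ⟨fun i => ?_, fun m hm => ?_, fun m hm => ?_⟩,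
    ⟨fun i => ?_, fun m hm => ((h1 m).1 hm).1, fun m hm => ((h2 m).1 hm).1⟩,
    ⟨fun i => ?_, fun m hm => ((h1 m).1 hm).2, fun m hm => ((h2 m).1 hm).2⟩, ?_, ?_, ?_, ?_, ?_⟩
  · ext x; simp [← hθ]
  · rw [h1]; simpa using hm
  · rw [h2]; simpa using hm
  · ext x; simp [← hθ]
  · rw [h1]; simpa using hm
  · rw [h2]; simpa using hm
  · ext x; simp [h3]
  · ext x; simp [h3]
  · simp
  · simp
  · simp
  · simp
  · intro s; simp [← map_add]

end basics
end SupCat.EP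

end

noncomputable section
set_option linter.unusedSectionVars false
namespace SupCat.EP
open SupCat SupCat.GSupMod

variable {k : Type} [Field k] [CharZero k]

section cliff
variable {r : ℕ}

lemma ac {M : GSupMod k (Fin r)} (h : VCat k r M) (i j : Fin r) (x : M.carrier) :
    M.θ i (M.θ j x) = - M.θ j (M.θ i x) :=
  eq_neg_of_add_eq_zero_left (LinearMap.congr_fun (h i j) x)

lemma vcat_of {M : GSupMod k (Fin r)} (h : ∀ i j x, M.θ i (M.θ j x) = - M.θ j (M.θ i x)) :
    VCat k r M := fun i j => LinearMap.ext fun x => by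
  simp [h i j x]

lemma sq0 {M : GSupMod k (Fin r)} (h : VCat k r M) (i : Fin r) (x : M.carrier) :
    M.θ i (M.θ i x) = 0 := self_eq_neg_k (k := k) (ac h i i x)

/-- partial contraction operators -/
def CliffOn (S : Finset (Fin r)) (M : GSupMod k (Fin r)) : Prop :=
  ∃ d : Fin r → (M.carrier →ₗ[k] M.carrier), ∀ i ∈ S,
    (∀ j x, d i (M.θ j x) + M.θ j (d i x) = if i = j then x else 0) ∧
    ∀ x, M.sigma (d i x) = - d i (M.sigma x)

/-- contraction operators for all generators: freeness -/
def Cliff (M : GSupMod k (Fin r)) : Prop := CliffOn Finset.univ M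

lemma cliff_d {M : GSupMod k (Fin r)} (h : Cliff M) :
    ∃ d : Fin r → (M.carrier →ₗ[k] M.carrier),
    (∀ i x, d i (M.θ i x) = x - M.θ i (d i x)) ∧
    (∀ i j x, i ≠ j → d i (M.θ j x) = - M.θ j (d i x)) ∧
    ∀ i x, M.sigma (d i x) = - d i (M.sigma x) := by
  obtain ⟨d, hd⟩ := h
  refine ⟨d, fun i x => ?_, fun i j x hij => ?_, fun i => (hd i (Finset.mem_univ _)).2⟩
  · have := (hd i (Finset.mem_univ _)).1 i x
    rw [if_pos rfl] at this
    exact eq_sub_of_add_eq this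
  · have := (hd i (Finset.mem_univ _)).1 j x
    rw [if_neg hij] at this
    exact eq_neg_of_add_eq_zero_left this

lemma even_avg {A B : GSupMod k (Fin r)} (h0 : A.carrier →ₗ[k] B.carrier) :
    ∃ h : A.carrier →ₗ[k] B.carrier, (∀ x, h (A.sigma x) = B.sigma (h x)) ∧
     ∀ x, h x = (2⁻¹ : k) • (h0 x + B.sigma (h0 (A.sigma x))) := by
  refine ⟨(2⁻¹ : k) • (h0 + B.sigma ∘ₗ h0 ∘ₗ A.sigma), fun x => ?_, fun x => ?_⟩
  · simp [sigma_sigma, add_comm]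
  · simp

lemma half_add {V : Type} [AddCommGroup V] [Module k V] (x : V) : (2⁻¹ : k) • (x + x) = x := by
  rw [← two_smul k x, smul_smul]; simp

lemma cliff_projective {P : GSupMod k (Fin r)} (hP : VCat k r P) (hc : Cliff P) :
    IsProjective (VCat k r) P := by
  refine ⟨hP, fun M N π f hM hN hπ hs hf => ?_⟩
  rw [isHom_iff] at hπ hf
  obtain ⟨d, d1, d2, d3⟩ := cliff_d hc
  have key : ∀ S : Finset (Fin r), ∃ h : P.carrier →ₗ[k] M.carrier,
      (∀ x, π (h x) = f x) ∧ (∀ x, h (P.sigma x) = M.sigma (h x)) ∧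
      ∀ i ∈ S, ∀ x, h (P.θ i x) = M.θ i (h x) := by
    intro S
    induction S using Finset.induction_on with
    | empty =>
      obtain ⟨s, hs⟩ := π.exists_rightInverse_of_surjective (LinearMap.range_eq_top.2 hs)
      have hs' : ∀ x, π (s x) = x := fun x => LinearMap.congr_fun hs x
      obtain ⟨h, h1, h2⟩ := even_avg (A := P) (B := M) (s ∘ₗ f)
      refine ⟨h, fun x => ?_, h1, by simp⟩
      rw [h2, map_smul, map_add, hπ.2]
      simp only [LinearMap.comp_apply, hs', hf.2, sigma_sigma]
      exact half_add _
    | insert i S hi ih =>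
      obtain ⟨h, h1, h2, h3⟩ := ih
      refine ⟨M.θ i ∘ₗ h ∘ₗ d i + h ∘ₗ d i ∘ₗ P.θ i, fun x => ?_, fun x => ?_, fun j hj x => ?_⟩
      · simp [h1, hπ.1, d1, hf.1]
      · simp only [LinearMap.add_apply, LinearMap.comp_apply, map_add]
        rw [sigma_θ, ← h2, d3, ← h2, d3, sigma_θ]; simp
      · simp only [LinearMap.add_apply, LinearMap.comp_apply, map_add]
        by_cases hij : i = j
        · subst hij
          simp [sq0 hM, sq0 hP]
        · have hjS : j ∈ S := by
            rcases Finset.mem_insert.1 hj with h | h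
            · exact absurd h.symm hij
            · exact h
          rw [d2 i j x hij, map_neg, h3 j hjS, map_neg, ac hM i j, ac hP i j, map_neg, d2 i j _ hij]
          simp [h3 j hjS]
  obtain ⟨h, h1, h2, h3⟩ := key Finset.univ
  exact ⟨h, (isHom_iff _ _ _).2 ⟨fun i => h3 i (Finset.mem_univ _), h2⟩, LinearMap.ext h1⟩

lemma cliff_injective {P : GSupMod k (Fin r)} (hP : VCat k r P) (hc : Cliff P) :
    IsInjective (VCat k r) P := by
  refine ⟨hP, fun M N π f hM hN hπ hs hf => ?_⟩
  rw [isHom_iff] at hπ hf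
  obtain ⟨d, d1, d2, d3⟩ := cliff_d hc
  have key : ∀ S : Finset (Fin r), ∃ h : N.carrier →ₗ[k] P.carrier,
      (∀ x, h (π x) = f x) ∧ (∀ x, h (N.sigma x) = P.sigma (h x)) ∧
      ∀ i ∈ S, ∀ x, h (N.θ i x) = P.θ i (h x) := by
    intro S
    induction S using Finset.induction_on with
    | empty =>
      obtain ⟨s, hs⟩ := π.exists_leftInverse_of_injective (LinearMap.ker_eq_bot.2 hs)
      have hs' : ∀ x, s (π x) = x := fun x => LinearMap.congr_fun hs x
      obtain ⟨h, h1, h2⟩ := even_avg (A := N) (B := P) (f ∘ₗ s)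
      refine ⟨h, fun x => ?_, h1, by simp⟩
      rw [h2, ← hπ.2]
      simp only [LinearMap.comp_apply, hs', hf.2, sigma_sigma]
      exact half_add _
    | insert i S hi ih =>
      obtain ⟨h, h1, h2, h3⟩ := ih
      refine ⟨P.θ i ∘ₗ d i ∘ₗ h + d i ∘ₗ h ∘ₗ N.θ i, fun x => ?_, fun x => ?_, fun j hj x => ?_⟩
      · simp [h1, ← hπ.1, d1, hf.1]
      · simp only [LinearMap.add_apply, LinearMap.comp_apply, map_add]
        rw [sigma_θ, d3, ← h2, d3, ← h2, sigma_θ]; simp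
      · simp only [LinearMap.add_apply, LinearMap.comp_apply, map_add]
        by_cases hij : i = j
        · subst hij
          simp [sq0 hN, sq0 hP]
        · have hjS : j ∈ S := by
            rcases Finset.mem_insert.1 hj with h | h
            · exact absurd h.symm hij
            · exact h
          rw [h3 j hjS, d2 i j _ hij, map_neg, ac hP i j, ac hN i j, map_neg, h3 j hjS, map_neg, d2 i j _ hij]
          simp
  obtain ⟨h, h1, h2, h3⟩ := key Finset.univ
  exact ⟨h, (isHom_iff _ _ _).2 ⟨fun i => h3 i (Finset.mem_univ _), h2⟩, LinearMap.ext h1⟩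

lemma cliff_retract {P Q : GSupMod k (Fin r)} {i : P.carrier →ₗ[k] Q.carrier}
    {p : Q.carrier →ₗ[k] P.carrier} (hi : IsHom P Q i) (hp : IsHom Q P p) (h : ∀ x, p (i x) = x)
    (hc : Cliff Q) : Cliff P := by
  obtain ⟨d, hd⟩ := hc
  rw [isHom_iff] at hi hp
  refine ⟨fun l => p ∘ₗ d l ∘ₗ i, fun l hl => ⟨fun j x => ?_, fun x => ?_⟩⟩
  · simp only [LinearMap.comp_apply]
    rw [hi.1, ← hp.1, ← map_add, (hd l hl).1]
    split_ifs <;> simp [h]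
  · simp only [LinearMap.comp_apply]
    rw [← hp.2, (hd l hl).2, hi.2, map_neg]

lemma vcat_sub {P Q : GSupMod k (Fin r)} {i : P.carrier →ₗ[k] Q.carrier} (hi : IsHom P Q i)
    (hinj : Function.Injective i) (h : VCat k r Q) : VCat k r P := by
  rw [isHom_iff] at hi
  refine vcat_of fun a b x => hinj ?_
  rw [map_neg, hi.1, hi.1, hi.1, hi.1, ac h]

lemma vcat_quot {P Q : GSupMod k (Fin r)} {i : P.carrier →ₗ[k] Q.carrier} (hi : IsHom P Q i)
    (hinj : Function.Surjective i) (h : VCat k r P) : VCat k r Q := by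
  rw [isHom_iff] at hi
  refine vcat_of fun a b x => ?_
  obtain ⟨x, rfl⟩ := hinj x
  rw [← hi.1, ← hi.1, ac h, map_neg, hi.1, hi.1]

/-- one step of the free cover -/
lemma cover_step {M : GSupMod k (Fin r)} (hM : VCat k r M) (S : Finset (Fin r)) (i : Fin r)
    (hS : CliffOn S M) (hi : i ∉ S) : ∃ (Q : GSupMod k (Fin r)) (π : Q.carrier →ₗ[k] M.carrier)
      (j : M.carrier →ₗ[k] Q.carrier),
      VCat k r Q ∧ CliffOn (insert i S) Q ∧ IsHom Q M π ∧ Function.Surjective π ∧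
      Function.Injective j ∧ (∀ l x, j (M.θ l x) = - Q.θ l (j x)) ∧
        ∀ x, j (M.sigma x) = - Q.sigma (j x) := by
  obtain ⟨d, hd⟩ := hS
  obtain ⟨Q, e, e1, e2⟩ := exists_mkS (M.carrier × M.carrier)
    (LinearMap.prodMap M.sigma (-M.sigma)) (by rintro ⟨x, y⟩; simp [sigma_sigma])
    (fun j => LinearMap.prodMap (M.θ j) (- M.θ j) +
      (if i = j then LinearMap.inr k _ _ ∘ₗ LinearMap.fst k _ _ else 0))
    (by
      rintro j ⟨x, y⟩
      by_cases h : i = j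
      · simp [h, sigma_θ]
      · simp [h, sigma_θ])
  have e1' : ∀ j x y, Q.θ j (e (x, y)) = e (M.θ j x, - M.θ j y + if i = j then x else 0) := by
    intro j x y
    rw [e1]; congr 1
    by_cases h : i = j <;> simp [h]
  have e2' : ∀ x y, Q.sigma (e (x, y)) = e (M.sigma x, - M.sigma y) := by
    intro x y
    rw [e2]; rfl
  refine ⟨Q, LinearMap.fst k _ _ ∘ₗ e.symm.toLinearMap, e.toLinearMap ∘ₗ LinearMap.inr k _ _,
    vcat_of ?_, ?_, ?_, ?_, ?_, ?_, ?_⟩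
  · intro a b z
    obtain ⟨⟨x, y⟩, rfl⟩ := e.surjective z
    rw [e1', e1', e1', e1', ← map_neg e, e.injective.eq_iff, Prod.neg_mk, Prod.mk.injEq]
    refine ⟨ac hM _ _ _, ?_⟩
    have := ac hM a b y
    split_ifs <;> simp [this] <;> abel
  · refine ⟨fun l => e.toLinearMap ∘ₗ (if l = i then LinearMap.inl k _ _ ∘ₗ LinearMap.snd k _ _ else
      LinearMap.prodMap (d l) (- d l)) ∘ₗ e.symm.toLinearMap, fun l hl => ?_⟩
    by_cases h : l = i
    · subst h
      refine ⟨fun j z => ?_, fun z => ?_⟩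
      · obtain ⟨⟨x, y⟩, rfl⟩ := e.surjective z
        simp only [LinearMap.comp_apply, LinearEquiv.coe_coe, LinearEquiv.symm_apply_apply, if_true,
          LinearMap.snd_apply, LinearMap.inl_apply, e1', ← map_add, Prod.mk_add_mk]
        split_ifs <;> simp
      · obtain ⟨⟨x, y⟩, rfl⟩ := e.surjective z
        simp [e2', ← map_neg]
    · have hl' : l ∈ S := (Finset.mem_insert.1 hl).resolve_left h
      refine ⟨fun j z => ?_, fun z => ?_⟩
      · obtain ⟨⟨x, y⟩, rfl⟩ := e.surjective z
        simp only [LinearMap.comp_apply, LinearEquiv.coe_coe, LinearEquiv.symm_apply_apply, if_neg h,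
          LinearMap.prodMap_apply, LinearMap.neg_apply, e1', ← map_add, Prod.mk_add_mk, (hd l hl').1]
        have h1 := (hd l hl').1 j y
        by_cases hij : i = j
        · have : ¬ l = j := fun h' => h (h'.trans hij.symm)
          rw [if_neg this] at h1
          simp only [hij, this, if_true, if_false, map_add, map_neg]
          have h1' := eq_neg_of_add_eq_zero_left h1
          rw [h1']
          simp
        · simp only [hij, if_false, add_zero, map_neg, neg_neg]
          rw [h1]; split_ifs <;> simp
      · obtain ⟨⟨x, y⟩, rfl⟩ := e.surjective z
        simp [e2', if_neg h, (hd l hl').2, ← map_neg]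
  · rw [isHom_iff]
    refine ⟨fun l z => ?_, fun z => ?_⟩
    · obtain ⟨⟨x, y⟩, rfl⟩ := e.surjective z
      rw [e1']; simp
    · obtain ⟨⟨x, y⟩, rfl⟩ := e.surjective z
      rw [e2']; simp
  · exact fun x => ⟨e (x, 0), by simp⟩
  · exact fun x y h => by simpa using h
  · intro l x
    simp [e1', ← map_neg]
  · intro x
    simp [e2', ← map_neg]

lemma cover_on {M : GSupMod k (Fin r)} (hM : VCat k r M) (S : Finset (Fin r)) :
    ∃ (Q : GSupMod k (Fin r)) (π : Q.carrier →ₗ[k] M.carrier),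
      VCat k r Q ∧ CliffOn S Q ∧ IsHom Q M π ∧ Function.Surjective π := by
  induction S using Finset.induction_on with
  | empty => exact ⟨M, LinearMap.id, hM, ⟨fun _ => 0, by simp⟩, isHom_id M, Function.surjective_id⟩
  | insert i S hi ih =>
    obtain ⟨Q, π, h1, h2, h3, h4⟩ := ih
    obtain ⟨Q', π', j, h1', h2', h3', h4', -⟩ := cover_step h1 S i h2 hi
    exact ⟨Q', π ∘ₗ π', h1', h2', isHom_comp h3 h3', h4.comp h4'⟩

lemma cover {M : GSupMod k (Fin r)} (hM : VCat k r M) :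
    ∃ (Q : GSupMod k (Fin r)) (π : Q.carrier →ₗ[k] M.carrier),
      VCat k r Q ∧ Cliff Q ∧ IsHom Q M π ∧ Function.Surjective π := cover_on hM _

/-- parity twist -/
lemma exists_twist {M : GSupMod k (Fin r)} (hM : VCat k r M) (S : Finset (Fin r)) (hS : CliffOn S M) :
    ∃ (Q : GSupMod k (Fin r)) (j : M.carrier →ₗ[k] Q.carrier),
      VCat k r Q ∧ CliffOn S Q ∧ Function.Injective j ∧ (∀ l x, j (M.θ l x) = - Q.θ l (j x)) ∧
        ∀ x, j (M.sigma x) = - Q.sigma (j x) := by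
  obtain ⟨d, hd⟩ := hS
  obtain ⟨Q, e, e1, e2⟩ := exists_mkS M.carrier (- M.sigma) (by simp [sigma_sigma])
    (fun i => - M.θ i) (by simp [sigma_θ])
  refine ⟨Q, e.toLinearMap, vcat_of fun i j z => ?_,
    ⟨fun i => e.toLinearMap ∘ₗ (- d i) ∘ₗ e.symm.toLinearMap, fun i hi => ⟨fun j z => ?_, fun z => ?_⟩⟩,
    e.injective, fun l x => ?_, fun x => ?_⟩
  · obtain ⟨x, rfl⟩ := e.surjective z
    simp [e1, ac hM i j]
  · obtain ⟨x, rfl⟩ := e.surjective z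
    simp [e1]
    rw [← map_add, (hd i hi).1]
    split_ifs <;> simp
  · obtain ⟨x, rfl⟩ := e.surjective z
    simp [e2, (hd i hi).2]
  · simp [e1]
  · simp [e2]

lemma hull_on {M : GSupMod k (Fin r)} (hM : VCat k r M) (S : Finset (Fin r)) :
    ∃ (Q : GSupMod k (Fin r)) (j : M.carrier →ₗ[k] Q.carrier),
      VCat k r Q ∧ CliffOn S Q ∧ IsHom M Q j ∧ Function.Injective j := by
  induction S using Finset.induction_on with
  | empty => exact ⟨M, LinearMap.id, hM, ⟨fun _ => 0, by simp⟩, isHom_id M, Function.injective_id⟩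
  | insert i S hi ih =>
    obtain ⟨Q, f, h1, h2, h3, h4⟩ := ih
    obtain ⟨Q2, g, a1, a2, a3, a4, a5⟩ := exists_twist h1 S h2
    obtain ⟨Q', π', j, h1', h2', -, -, b1, b2, b3⟩ := cover_step a1 S i a2 hi
    rw [isHom_iff] at h3
    refine ⟨Q', j ∘ₗ g ∘ₗ f, h1', h2', (isHom_iff _ _ _).2 ⟨fun l x => ?_, fun x => ?_⟩,
      b1.comp (a3.comp h4)⟩
    · simp [h3.1, a4, b2]
    · simp [h3.2, a5, b3]

lemma hull {M : GSupMod k (Fin r)} (hM : VCat k r M) :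
    ∃ (Q : GSupMod k (Fin r)) (j : M.carrier →ₗ[k] Q.carrier),
      VCat k r Q ∧ Cliff Q ∧ IsHom M Q j ∧ Function.Injective j := hull_on hM _

lemma projective_cliff {P : GSupMod k (Fin r)} (h : IsProjective (VCat k r) P) : Cliff P := by
  obtain ⟨Q, π, h1, h2, h3, h4⟩ := cover h.1
  obtain ⟨i, hi, hi2⟩ := h.2 Q P π LinearMap.id h1 h.1 h3 h4 (isHom_id P)
  exact cliff_retract hi h3 (fun x => LinearMap.congr_fun hi2 x) h2

end cliff
end SupCat.EP

end

noncomputable section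
set_option linter.unusedSectionVars false
namespace SupCat.EP
open SupCat SupCat.GSupMod

section ringlemmas
variable {R : Type*} [Ring R] {ι : Type} [DecidableEq ι] (A : ι → R)

/-- ordered product -/
def Pr (l : List ι) : R := (l.map A).prod

@[simp] lemma Pr_nil : Pr A [] = 1 := rfl
@[simp] lemma Pr_cons (i : ι) (l : List ι) : Pr A (i :: l) = A i * Pr A l := by simp [Pr]
lemma Pr_append (l l2 : List ι) : Pr A (l ++ l2) = Pr A l * Pr A l2 := by simp [Pr]

variable {A}

lemma Pr_comm (hac : ∀ i j, A i * A j = -(A j * A i)) (i : ι) (l : List ι) : A i * Pr A l = (-1) ^ l.length * (Pr A l * A i) := by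
  induction l with
  | nil => simp
  | cons j l ih =>
    rw [Pr_cons, ← mul_assoc, hac i j, neg_mul, mul_assoc, ih, List.length_cons, pow_succ]
    have : A j * ((-1) ^ l.length * (Pr A l * A i)) = (-1) ^ l.length * (A j * (Pr A l * A i)) := by
      rw [← mul_assoc, ← ((Commute.neg_one_left (A j)).pow_left l.length).eq, mul_assoc]
    rw [this]; simp [mul_assoc]


lemma Pr_left (hac : ∀ i j, A i * A j = -(A j * A i)) (hsq : ∀ i, A i * A i = 0)
    (i : ι) (l : List ι) (h : i ∈ l) : A i * Pr A l = 0 := by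
  induction l with
  | nil => simp at h
  | cons j l ih =>
    rw [Pr_cons, ← mul_assoc]
    by_cases hij : i = j
    · rw [← hij, hsq, zero_mul]
    · rw [hac, neg_mul, mul_assoc, ih ((List.mem_cons.1 h).resolve_left hij)]; simp

lemma Pr_right (hac : ∀ i j, A i * A j = -(A j * A i)) (hsq : ∀ i, A i * A i = 0)
    (i : ι) (l : List ι) (h : i ∈ l) : Pr A l * A i = 0 := by
  have h1 := Pr_left hac hsq i l h
  rw [Pr_comm hac] at h1
  have h2 : ((-1 : R) ^ l.length) * ((-1 : R) ^ l.length) = 1 := by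
    rw [← pow_add, Even.neg_one_pow (Even.add_self _)]
  rw [← one_mul (Pr A l * A i), ← h2, mul_assoc, h1, mul_zero]

lemma Pr_erase (hac : ∀ i j, A i * A j = -(A j * A i)) (hsq : ∀ i, A i * A i = 0)
    (i : ι) (l : List ι) (h : i ∈ l) :
    Pr A l = A i * Pr A (l.erase i) ∨ Pr A l = -(A i * Pr A (l.erase i)) := by
  induction l with
  | nil => simp at h
  | cons j l ih =>
    by_cases hij : j = i
    · subst hij; left; simp
    · have h' := (List.mem_cons.1 h).resolve_left (fun h => hij h.symm)
      rw [List.erase_cons_tail (by simpa using hij), Pr_cons, Pr_cons]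
      rcases ih h' with h2 | h2
      · right; rw [h2, ← mul_assoc, hac, neg_mul, mul_assoc]
      · left; rw [h2, mul_neg, ← mul_assoc, hac, neg_mul, mul_assoc, neg_neg]

end ringlemmas

section ad
variable {R : Type*} [Ring R] (s : R)

/-- super-commutator with an odd element -/
def ad (a h : R) : R := a * h - s * h * s * a

variable {s}

lemma ad_anti (hs : s * s = 1) {a b : R} (ha : s * a = -(a * s)) (hb : s * b = -(b * s)) (hab : a * b = -(b * a))
    (h : R) : ad s a (ad s b h) = - ad s b (ad s a h) := by
  have hs' : ∀ x, s * (s * x) = x := fun x => by rw [← mul_assoc, hs, one_mul]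
  have ha' : ∀ x, s * (a * x) = -(a * (s * x)) := fun x => by
    rw [← mul_assoc, ha, neg_mul, mul_assoc]
  have hb' : ∀ x, s * (b * x) = -(b * (s * x)) := fun x => by
    rw [← mul_assoc, hb, neg_mul, mul_assoc]
  have hab' : ∀ x, a * (b * x) = -(b * (a * x)) := fun x => by
    rw [← mul_assoc, hab, neg_mul, mul_assoc]
  simp only [ad, mul_sub, sub_mul, mul_assoc, hs', ha', hb', hab, hab', mul_neg, neg_mul, neg_neg, hs, one_mul]
  abel

lemma ad_sigma (hs : s * s = 1) {a : R} (ha : s * a = -(a * s)) (h : R) : s * ad s a h * s = - ad s a (s * h * s) := by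
  have hs' : ∀ x, s * (s * x) = x := fun x => by rw [← mul_assoc, hs, one_mul]
  have ha' : ∀ x, s * (a * x) = -(a * (s * x)) := fun x => by
    rw [← mul_assoc, ha, neg_mul, mul_assoc]
  have ha2 : a * s = -(s * a) := by rw [ha, neg_neg]
  simp only [ad, mul_sub, sub_mul, mul_assoc, hs', ha', ha2, mul_neg, neg_mul, neg_neg, hs, one_mul]
  abel

end ad

variable {k : Type} [Field k] [CharZero k]

section top
variable {r : ℕ}

/-- the product of the operators along a list -/
def pl (M : GSupMod k (Fin r)) (l : List (Fin r)) : M.carrier →ₗ[k] M.carrier :=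
  Pr (R := Module.End k M.carrier) M.θ l

/-- the top form -/
def tp (M : GSupMod k (Fin r)) : M.carrier →ₗ[k] M.carrier := pl M (List.finRange r)

@[simp] lemma pl_nil (M : GSupMod k (Fin r)) (x : M.carrier) : pl M [] x = x := rfl
@[simp] lemma pl_cons (M : GSupMod k (Fin r)) (i : Fin r) (l) (x : M.carrier) :
    pl M (i :: l) x = M.θ i (pl M l x) := by
  simp [pl]

lemma rac {M : GSupMod k (Fin r)} (h : VCat k r M) (i j : Fin r) :
    (M.θ i : Module.End k M.carrier) * M.θ j = -(M.θ j * M.θ i) := LinearMap.ext (ac h i j)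

lemma rsq {M : GSupMod k (Fin r)} (h : VCat k r M) (i : Fin r) :
    (M.θ i : Module.End k M.carrier) * M.θ i = 0 := LinearMap.ext (sq0 h i)

lemma hom_pl {M N : GSupMod k (Fin r)} {f : M.carrier →ₗ[k] N.carrier} (hf : IsHom M N f)
    (l : List (Fin r)) (x : M.carrier) : f (pl M l x) = pl N l (f x) := by
  rw [isHom_iff] at hf
  induction l with
  | nil => simp
  | cons i l ih => simp [hf.1, ih]

lemma hom_tp {M N : GSupMod k (Fin r)} {f : M.carrier →ₗ[k] N.carrier} (hf : IsHom M N f)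
    (x : M.carrier) : f (tp M x) = tp N (f x) := hom_pl hf _ _

lemma θ_tp {M : GSupMod k (Fin r)} (h : VCat k r M) (i : Fin r) (x) : M.θ i (tp M x) = 0 :=
  LinearMap.congr_fun (Pr_left (rac h) (rsq h) i (List.finRange r) (List.mem_finRange i)) x

lemma tp_θ {M : GSupMod k (Fin r)} (h : VCat k r M) (i : Fin r) (x) : tp M (M.θ i x) = 0 :=
  LinearMap.congr_fun (Pr_right (rac h) (rsq h) i (List.finRange r) (List.mem_finRange i)) x

/-- contraction can be used to express elements killed by everything -/
lemma soc_mem {M : GSupMod k (Fin r)} (hc : Cliff M) (l : List (Fin r)) (hl : l.Nodup)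
    {x : M.carrier} (hx : ∀ i, M.θ i x = 0) : ∃ y, x = pl M l y := by
  obtain ⟨d, d1, d2, d3⟩ := cliff_d hc
  suffices H : ∀ (l : List (Fin r)), l.Nodup → ∀ x, (∀ i ∈ l, M.θ i x = 0) → ∃ y, x = pl M l y from
    H l hl x (fun i _ => hx i)
  intro l
  induction l with
  | nil => intro _ x _; exact ⟨x, by simp⟩
  | cons i l ih =>
    intro hl x hx
    have hl' := List.nodup_cons.1 hl
    have h1 : x = M.θ i (d i x) := by
      have := d1 i x
      rw [hx i (by simp), map_zero] at this
      exact sub_eq_zero.1 this.symm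
    obtain ⟨y, hy⟩ := ih hl'.2 (d i x) (fun j hj => by
      have hne : i ≠ j := fun h => hl'.1 (h ▸ hj)
      have := d2 i j x hne
      rw [hx j (by simp [hj]), map_zero] at this
      exact neg_eq_zero.1 this.symm)
    exact ⟨y, by rw [pl_cons, ← hy, ← h1]⟩

/-- nonzero invariant subspaces contain invariants -/
lemma exists_soc {M : GSupMod k (Fin r)} (h : VCat k r M) (N : Submodule k M.carrier)
    (hN : ∀ i, ∀ x ∈ N, M.θ i x ∈ N) (h0 : N ≠ ⊥) : ∃ x ∈ N, x ≠ 0 ∧ ∀ i, M.θ i x = 0 := by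
  have key : ∀ S : Finset (Fin r), ∃ x ∈ N, x ≠ 0 ∧ ∀ i ∈ S, M.θ i x = 0 := by
    intro S
    induction S using Finset.induction_on with
    | empty =>
      obtain ⟨x, hx, hx0⟩ := N.ne_bot_iff.1 h0
      exact ⟨x, hx, hx0, by simp⟩
    | insert i S hi ih =>
      obtain ⟨x, hx, hx0, hxS⟩ := ih
      by_cases hz : M.θ i x = 0
      · exact ⟨x, hx, hx0, by simpa [hz] using hxS⟩
      · refine ⟨M.θ i x, hN i x hx, hz, fun j hj => ?_⟩
        rcases Finset.mem_insert.1 hj with rfl | hj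
        · exact sq0 h _ _
        · rw [ac h, hxS j hj]; simp
  obtain ⟨x, h1, h2, h3⟩ := key Finset.univ
  exact ⟨x, h1, h2, fun i => h3 i (Finset.mem_univ _)⟩

lemma cliff_zero {M : GSupMod k (Fin r)} (h : VCat k r M) (hc : Cliff M) (l : List (Fin r))
    (hl : l.Nodup) (h0 : ∀ x, pl M l x = 0) (x : M.carrier) : x = 0 := by
  by_contra hx
  have : (⊤ : Submodule k M.carrier) ≠ ⊥ := (Submodule.ne_bot_iff _).2 ⟨x, trivial, hx⟩
  obtain ⟨y, -, hy, hy2⟩ := exists_soc h ⊤ (fun _ _ _ => trivial) this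
  obtain ⟨z, rfl⟩ := soc_mem hc l hl hy2
  exact hy (h0 z)

lemma compl_projs {A B S : GSupMod k (Fin r)} {iA : A.carrier →ₗ[k] S.carrier}
    {iB : B.carrier →ₗ[k] S.carrier}
    (hA : IsHom A S iA) (hB : IsHom B S iB) (injA : Function.Injective iA)
    (injB : Function.Injective iB) (hc : IsCompl (LinearMap.range iA) (LinearMap.range iB)) :
    ∃ (pA : S.carrier →ₗ[k] A.carrier) (pB : S.carrier →ₗ[k] B.carrier),
      IsHom S A pA ∧ IsHom S B pB ∧
      (∀ a, pA (iA a) = a) ∧ (∀ b, pB (iB b) = b) ∧ (∀ a, pB (iA a) = 0) ∧ (∀ b, pA (iB b) = 0) ∧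
      (∀ s, iA (pA s) + iB (pB s) = s) := by
  rw [isHom_iff] at hA hB
  let ψ : (A.carrier × B.carrier) →ₗ[k] S.carrier := iA.coprod iB
  have hψ : Function.Bijective ψ := by
    constructor
    · rw [← LinearMap.ker_eq_bot, LinearMap.ker_eq_bot']
      rintro ⟨a, b⟩ h
      have h1 : iA a + iB b = 0 := by simpa [ψ] using h
      have h2 : iA a = 0 := by
        refine (Submodule.disjoint_def.1 hc.disjoint) _ ⟨a, rfl⟩ ⟨-b, ?_⟩
        rw [map_neg, eq_neg_of_add_eq_zero_left h1]
      have h3 : iB b = 0 := by rwa [h2, zero_add] at h1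
      rw [injA (h2.trans (map_zero _).symm), injB (h3.trans (map_zero _).symm)]; rfl
    · rw [← LinearMap.range_eq_top, LinearMap.range_coprod, hc.sup_eq_top]
  let φ := (LinearEquiv.ofBijective ψ hψ)
  have key : ∀ a b, φ.symm (iA a + iB b) = (a, b) := fun a b => by
    rw [LinearEquiv.symm_apply_eq]; simp [φ, ψ]
  have dec : ∀ s, ∃ a b, s = iA a + iB b := fun s => by
    obtain ⟨⟨a, b⟩, h⟩ := hψ.2 s
    exact ⟨a, b, by rw [← h]; simp [ψ]⟩
  have kA : ∀ a, φ.symm (iA a) = (a, 0) := fun a => by simpa using key a 0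
  have kB : ∀ b, φ.symm (iB b) = (0, b) := fun b => by simpa using key 0 b
  refine ⟨LinearMap.fst k _ _ ∘ₗ φ.symm.toLinearMap, LinearMap.snd k _ _ ∘ₗ φ.symm.toLinearMap,
    (isHom_iff _ _ _).2 ⟨fun i s => ?_, fun s => ?_⟩, (isHom_iff _ _ _).2 ⟨fun i s => ?_, fun s => ?_⟩,
    fun a => by simp [kA], fun b => by simp [kB], fun a => by simp [kA], fun b => by simp [kB], fun s => ?_⟩
  all_goals obtain ⟨a, b, rfl⟩ := dec s
  · simp [← hA.1, ← hB.1, kA, kB]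
  · simp [← hA.2, ← hB.2, kA, kB]
  · simp [← hA.1, ← hB.1, kA, kB]
  · simp [← hA.2, ← hB.2, kA, kB]
  · simp [kA, kB]

end top
end SupCat.EP

end

noncomputable section
set_option linter.unusedSectionVars false
namespace SupCat.EP
open SupCat SupCat.GSupMod
variable {k : Type} [Field k] [CharZero k]

section dec
variable {r : ℕ}

lemma exists_ginv {V : Type} [AddCommGroup V] [Module k V] (t : V →ₗ[k] V) :
    ∃ g : V →ₗ[k] V, ∀ x, t (g (t x)) = t x := by
  obtain ⟨s, hs⟩ := t.rangeRestrict.exists_rightInverse_of_surjective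
    (LinearMap.range_eq_top.2 t.surjective_rangeRestrict)
  obtain ⟨g, hg⟩ := LinearMap.exists_extend s
  refine ⟨g, fun x => ?_⟩
  have h1 : g (t x) = s (t.rangeRestrict x) := LinearMap.congr_fun hg (t.rangeRestrict x)
  have h2 := congrArg Subtype.val (LinearMap.congr_fun hs (t.rangeRestrict x))
  rw [h1]; exact h2

lemma sigma_pl (M : GSupMod k (Fin r)) (l : List (Fin r)) (x : M.carrier) :
    M.sigma (pl M l x) = (-1 : k) ^ l.length • pl M l (M.sigma x) := by
  induction l with
  | nil => simp
  | cons i l ih => simp [sigma_θ, ih, pow_succ]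

lemma exists_eD {M : GSupMod k (Fin r)} (hM : VCat k r M) :
    ∃ (e : M.carrier →ₗ[k] M.carrier) (D : Fin r → (M.carrier →ₗ[k] M.carrier)),
    (∀ x, e (M.sigma x) = M.sigma (e x)) ∧ (∀ i x, e (M.θ i x) = M.θ i (e x)) ∧
    (∀ x, e (tp M x) = tp M x) ∧
    (∀ i j x, D i (M.θ j x) + M.θ j (D i x) = if i = j then e x else 0) ∧
    (∀ i x, M.sigma (D i x) = - D i (M.sigma x)) := by
  obtain ⟨g', hg'⟩ := exists_ginv (tp M)
  have ee : ((-1 : k) ^ r) * ((-1 : k) ^ r) = 1 := by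
    rw [← pow_add, Even.neg_one_pow (Even.add_self _)]
  let R := Module.End k M.carrier
  let s : R := M.sigma
  have hs : s * s = 1 := LinearMap.ext (sigma_sigma M)
  have hsθ : ∀ i, s * (M.θ i : R) = -((M.θ i : R) * s) := fun i => LinearMap.ext (sigma_θ M i)
  let g : R := (2⁻¹ : k) • (g' + (-1 : k) ^ r • (s * g' * s))
  have hgs : s * g * s = (-1 : k) ^ r • g := by
    simp only [g, mul_smul_comm, smul_mul_assoc, mul_add, add_mul, smul_add, smul_smul]
    have : s * (s * g' * s) * s = g' := by
      rw [show s * (s * g' * s) * s = (s * s) * g' * (s * s) by simp only [mul_assoc], hs]; simp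
    rw [this, add_comm]
    congr 2
    · exact mul_comm _ _
    · rw [mul_left_comm, ee, mul_one]
  have hst : ∀ x, M.sigma (tp M x) = (-1 : k) ^ r • tp M (M.sigma x) := fun x => by
    have := sigma_pl M (List.finRange r) x
    rwa [List.length_finRange] at this
  have hts : ∀ x, tp M (M.sigma x) = (-1 : k) ^ r • M.sigma (tp M x) := fun x => by
    rw [hst, smul_smul, ee, one_smul]
  have htgt : ∀ x, tp M (g (tp M x)) = tp M x := by
    intro x
    have h1 : g (tp M x) = (2⁻¹ : k) • (g' (tp M x) + (-1 : k) ^ r • M.sigma (g' (M.sigma (tp M x)))) := rfl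
    have h2 : tp M (M.sigma (g' (M.sigma (tp M x)))) = (-1 : k) ^ r • tp M x := by
      rw [hst x, map_smul, map_smul, map_smul, hts, hg', hst, sigma_sigma, smul_smul, ee, one_smul]
    rw [h1, map_smul, map_add, hg', map_smul, h2, smul_smul, ee, one_smul]
    exact half_add _
  let Ad : Fin r → Module.End k R := fun i =>
    { toFun := ad s (M.θ i)
      map_add' := fun a b => by simp only [ad, mul_add, add_mul]; abel
      map_smul' := fun c a => by simp [ad, smul_sub] }
  have hAd : ∀ i h, Ad i h = (M.θ i : R) * h - s * h * s * (M.θ i : R) := fun i h => rfl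
  have Adac : ∀ i j, Ad i * Ad j = -(Ad j * Ad i) := fun i j => LinearMap.ext fun h =>
    ad_anti hs (hsθ i) (hsθ j) (rac hM i j) h
  have Adsq : ∀ i, Ad i * Ad i = 0 := fun i => LinearMap.ext fun h =>
    self_eq_neg_k (k := k) (LinearMap.congr_fun (Adac i i) h)
  have Ads : ∀ l h, s * (Pr Ad l h) * s = (-1 : k) ^ l.length • Pr Ad l (s * h * s) := by
    intro l h
    induction l with
    | nil => simp
    | cons i l ih =>
      rw [Pr_cons, Module.End.mul_apply, Module.End.mul_apply]
      have h1 : s * Ad i (Pr Ad l h) * s = - Ad i (s * Pr Ad l h * s) := ad_sigma hs (hsθ i) _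
      rw [h1, ih, map_smul, List.length_cons, pow_succ]; simp
  have Adt : ∀ l h x, (Pr Ad l h) (tp M x) = pl M l (h (tp M x)) := by
    intro l h x
    induction l with
    | nil => simp
    | cons i l ih =>
      rw [Pr_cons, Module.End.mul_apply, hAd, pl_cons, ← ih]
      show M.θ i ((Pr Ad l h) (tp M x)) - (s * (Pr Ad l h) * s) (M.θ i (tp M x)) = _
      rw [θ_tp hM, map_zero, sub_zero]
  let e : R := Pr Ad (List.finRange r) g
  have hes : s * e * s = e := by
    rw [Ads, hgs, map_smul, smul_smul, List.length_finRange, ee, one_smul]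
  have hsplit : ∀ i, ∃ D : R, Ad i D = e ∧ (∀ j, i ≠ j → Ad j D = 0) ∧ s * D * s = - D := by
    intro i
    have hmem := List.mem_finRange i
    have hpar : ∀ c : k, s * (c • Pr Ad ((List.finRange r).erase i) g) * s =
        - (c • Pr Ad ((List.finRange r).erase i) g) := by
      intro c
      rw [mul_smul_comm, smul_mul_assoc, Ads, hgs, map_smul, List.length_erase_of_mem hmem, List.length_finRange, smul_smul, smul_smul,
        mul_assoc, ← pow_add]
      have : (-1 : k) ^ (r - 1 + r) = -1 := by
        apply Odd.neg_one_pow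
        have := i.pos
        exact ⟨r - 1, by omega⟩
      rw [this]; simp
    have hz : ∀ (c : k) j, i ≠ j → Ad j (c • Pr Ad ((List.finRange r).erase i) g) = 0 := by
      intro c j hj
      rw [map_smul, ← Module.End.mul_apply, Pr_left Adac Adsq j _
        ((List.mem_erase_of_ne (Ne.symm hj)).2 (List.mem_finRange j))]
      simp
    rcases Pr_erase Adac Adsq i _ hmem with h | h
    · refine ⟨(1 : k) • Pr Ad ((List.finRange r).erase i) g, ?_, hz 1, hpar 1⟩
      rw [one_smul, ← Module.End.mul_apply, ← h]
    · refine ⟨(-1 : k) • Pr Ad ((List.finRange r).erase i) g, ?_, hz (-1), hpar (-1)⟩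
      have h3 : e = -((Ad i * Pr Ad ((List.finRange r).erase i)) g) := by
        simp only [e]; rw [h]; rfl
      rw [h3, map_smul, Module.End.mul_apply]; simp
  choose D hD1 hD2 hD3 using hsplit
  have hsx : ∀ (h : R) x, (s * h * s) x = M.sigma (h (M.sigma x)) := fun h x => rfl
  refine ⟨e, D, fun x => ?_, fun i x => ?_, fun x => ?_, fun i j x => ?_, fun i x => ?_⟩
  · have := LinearMap.congr_fun hes x
    rw [hsx] at this
    rw [← this, sigma_sigma]
  · have h1 : Ad i e = 0 := by
      have := LinearMap.congr_fun (Pr_left Adac Adsq i (List.finRange r) (List.mem_finRange i)) g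
      exact this
    rw [hAd, hes] at h1
    exact (LinearMap.congr_fun (sub_eq_zero.1 h1) x).symm
  · rw [Adt]; exact htgt x
  · have h1 : Ad j (D i) = (M.θ j : R) * D i + D i * (M.θ j : R) := by
      rw [hAd, hD3, neg_mul, sub_neg_eq_add]
    have h2 : D i (M.θ j x) + M.θ j (D i x) = Ad j (D i) x := by rw [h1, add_comm]; rfl
    rw [h2]
    split_ifs with hij
    · subst hij; rw [hD1]
    · rw [hD2 i j hij]; rfl
  · have := LinearMap.congr_fun (hD3 i) (M.sigma x)
    rw [hsx, sigma_sigma] at this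
    exact this

lemma decompose {M : GSupMod k (Fin r)} (hM : VCat k r M) :
    ∃ C F : GSupMod k (Fin r), IsDsum C F M ∧ Cliff F ∧ VCat k r F ∧ VCat k r C ∧ ∀ x, tp C x = 0 := by
  obtain ⟨e, D, e1, e2, e3, hD, hDs⟩ := exists_eD hM
  obtain ⟨n, hn⟩ := Filter.eventually_atTop.1 (LinearMap.eventually_isCompl_ker_pow_range_pow (e : Module.End k M.carrier))
  have hc := hn (n + 1) (by omega)
  generalize hm : n + 1 = m at hc
  have em1 : ∀ x, (e ^ m) (M.sigma x) = M.sigma ((e ^ m) x) := by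
    intro x
    have : Commute e M.sigma := LinearMap.ext e1
    exact LinearMap.congr_fun (this.pow_left m).eq x
  have em2 : ∀ i x, (e ^ m) (M.θ i x) = M.θ i ((e ^ m) x) := by
    intro i x
    have : Commute e (M.θ i) := LinearMap.ext (e2 i)
    exact LinearMap.congr_fun (this.pow_left m).eq x
  have em3 : ∀ x, (e ^ m) (tp M x) = tp M x := by
    intro x
    clear hm hc em1 em2
    induction m with
    | zero => rfl
    | succ m ih => rw [pow_succ, Module.End.mul_apply, e3, ih]
  have hem : IsHom M M (e ^ m) := (isHom_iff _ _ _).2 ⟨em2, em1⟩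
  obtain ⟨C, i, hi, iinj, ir⟩ := exists_sub M (LinearMap.ker (e ^ m))
    (fun i x hx => by rw [LinearMap.mem_ker] at *; rw [em2, hx, map_zero])
    (fun x hx => by rw [LinearMap.mem_ker] at *; rw [em1, hx, map_zero])
  obtain ⟨F, f, hf, finj, fr⟩ := exists_sub M (LinearMap.range (e ^ m))
    (fun i x hx => by obtain ⟨y, rfl⟩ := hx; exact ⟨M.θ i y, em2 i y⟩)
    (fun x hx => by obtain ⟨y, rfl⟩ := hx; exact ⟨M.sigma y, em1 y⟩)
  have hc' : IsCompl (LinearMap.range i) (LinearMap.range f) := by rw [ir, fr]; exact hc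
  have hVF := vcat_sub hf finj hM
  refine ⟨C, F, isDsum_of_maps hi hf iinj finj hc', ?_, hVF, vcat_sub hi iinj hM, fun x => iinj ?_⟩
  · obtain ⟨pC, pF, a1, a2, a3, a4, a5, a6, a7⟩ := compl_projs hi hf iinj finj hc'
    have heh : IsHom M M e := (isHom_iff _ _ _).2 ⟨e2, e1⟩
    let u : F.carrier →ₗ[k] F.carrier := pF ∘ₗ e ∘ₗ f
    have hu : IsHom F F u := isHom_comp a2 (isHom_comp heh hf)
    have hfu : ∀ x, f (u x) = e (f x) := by
      intro x
      have h1 : e (f x) ∈ LinearMap.range f := by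
        have : f x ∈ LinearMap.range (e ^ m) := by rw [← fr]; exact ⟨x, rfl⟩
        obtain ⟨y, hy⟩ := this
        rw [fr, ← hy]
        refine ⟨e y, ?_⟩
        have : Commute e (e ^ m) := (Commute.refl e).pow_right m
        exact (LinearMap.congr_fun this.eq y).symm
      obtain ⟨z, hz⟩ := h1
      show f (pF (e (f x))) = _
      rw [← hz, a4]
    have uinj : Function.Injective u := by
      rw [← LinearMap.ker_eq_bot, LinearMap.ker_eq_bot']
      intro x hx
      have h1 : e (f x) = 0 := by rw [← hfu, hx, map_zero]
      have h2 : f x ∈ LinearMap.ker (e ^ m) := by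
        rw [LinearMap.mem_ker, ← hm, pow_succ, Module.End.mul_apply, h1, map_zero]
      have h3 : f x ∈ LinearMap.range (e ^ m) := by rw [← fr]; exact ⟨x, rfl⟩
      exact finj ((Submodule.disjoint_def.1 hc.disjoint _ h2 h3).trans (map_zero f).symm)
    let U := LinearEquiv.ofInjectiveEndo u uinj
    have hU : ∀ x, U x = u x := fun x => rfl
    rw [isHom_iff] at hu a2 hf
    have hUθ : ∀ i x, U.symm (F.θ i x) = F.θ i (U.symm x) := by
      intro i x
      rw [LinearEquiv.symm_apply_eq, hU, hu.1, ← hU]; simp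
    have hUs : ∀ x, U.symm (F.sigma x) = F.sigma (U.symm x) := by
      intro x
      rw [LinearEquiv.symm_apply_eq, hU, hu.2, ← hU]; simp
    refine ⟨fun l => U.symm.toLinearMap ∘ₗ pF ∘ₗ D l ∘ₗ f, fun l _ => ⟨fun j x => ?_, fun x => ?_⟩⟩
    · simp only [LinearMap.comp_apply, LinearEquiv.coe_coe]
      rw [← hUθ, ← a2.1, ← map_add, ← map_add, hf.1, hD]
      split_ifs
      · rw [LinearEquiv.symm_apply_eq, hU]; rfl
      · simp
    · simp only [LinearMap.comp_apply, LinearEquiv.coe_coe]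
      rw [← hUs, ← a2.2, hDs, hf.2]; simp
  · rw [hom_tp hi, map_zero]
    have h1 : i x ∈ LinearMap.ker (e ^ m) := by rw [← ir]; exact ⟨x, rfl⟩
    rw [← em3, hom_tp hem, LinearMap.mem_ker.1 h1, map_zero]

end dec
end SupCat.EP

end

noncomputable section
set_option linter.unusedSectionVars false
namespace SupCat.EP
open SupCat SupCat.GSupMod
variable {k : Type} [Field k] [CharZero k]

section syz
variable {r : ℕ}

/-- short exact sequences with free middle term -/
def Syz (A B : GSupMod k (Fin r)) : Prop :=
  ∃ (Q : GSupMod k (Fin r)) (j : B.carrier →ₗ[k] Q.carrier) (π : Q.carrier →ₗ[k] A.carrier),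
    VCat k r Q ∧ Cliff Q ∧ IsHom B Q j ∧ Function.Injective j ∧ IsHom Q A π ∧ Function.Surjective π ∧
    LinearMap.range j = LinearMap.ker π

lemma ker_inv {A B : GSupMod k (Fin r)} {f : A.carrier →ₗ[k] B.carrier} (hf : IsHom A B f) (i : Fin r) :
    ∀ x ∈ LinearMap.ker f, A.θ i x ∈ LinearMap.ker f := by
  rw [isHom_iff] at hf
  intro x hx
  rw [LinearMap.mem_ker] at *
  rw [hf.1, hx, map_zero]

lemma ker_inv_s {A B : GSupMod k (Fin r)} {f : A.carrier →ₗ[k] B.carrier} (hf : IsHom A B f) :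
    ∀ x ∈ LinearMap.ker f, A.sigma x ∈ LinearMap.ker f := by
  rw [isHom_iff] at hf
  intro x hx
  rw [LinearMap.mem_ker] at *
  rw [hf.2, hx, map_zero]

lemma range_inv {A B : GSupMod k (Fin r)} {f : A.carrier →ₗ[k] B.carrier} (hf : IsHom A B f) (i : Fin r) :
    ∀ x ∈ LinearMap.range f, B.θ i x ∈ LinearMap.range f := by
  rw [isHom_iff] at hf
  rintro _ ⟨x, rfl⟩
  exact ⟨A.θ i x, hf.1 i x⟩

lemma range_inv_s {A B : GSupMod k (Fin r)} {f : A.carrier →ₗ[k] B.carrier} (hf : IsHom A B f) :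
    ∀ x ∈ LinearMap.range f, B.sigma x ∈ LinearMap.range f := by
  rw [isHom_iff] at hf
  rintro _ ⟨x, rfl⟩
  exact ⟨A.sigma x, hf.2 x⟩

lemma isHom_sub {A B : GSupMod k (Fin r)} {f g : A.carrier →ₗ[k] B.carrier} (hf : IsHom A B f)
    (hg : IsHom A B g) : IsHom A B (f - g) := by
  rw [isHom_iff] at *
  exact ⟨fun i x => by simp [hf.1, hg.1], fun x => by simp [hf.2, hg.2]⟩

lemma syz_isSyzygy {A B : GSupMod k (Fin r)} (h : Syz A B) (tA : ∀ x, tp A x = 0)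
    (tB : ∀ x, tp B x = 0) : IsSyzygy (VCat k r) A B := by
  obtain ⟨Q, j, π, hQ, hc, hj, jinj, hπ, πs, hr⟩ := h
  have hA := vcat_quot hπ πs hQ
  refine ⟨vcat_sub hj jinj hQ, Q, π, j, ⟨cliff_projective hQ hc, hπ, πs, ?_⟩, hj, jinj, hr⟩
  intro Q2 f hQ2 hf hs
  obtain ⟨h, hh, hh2⟩ := (cliff_projective hQ hc).2 Q2 A (π ∘ₗ f) π hQ2 hA (isHom_comp hπ hf) hs hπ
  have hu : IsHom Q Q (f ∘ₗ h) := isHom_comp hf hh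
  have hu2 : ∀ x, π (f (h x)) = π x := fun x => LinearMap.congr_fun hh2 x
  have uinj : Function.Injective (f ∘ₗ h) := by
    rw [← LinearMap.ker_eq_bot]
    by_contra hne
    obtain ⟨x, hx, hx0, hxs⟩ := exists_soc hQ _ (ker_inv hu) hne
    obtain ⟨z, rfl⟩ := soc_mem hc _ (List.nodup_finRange r) hxs
    have h1 : f (h z) - z ∈ LinearMap.range j := by
      rw [hr, LinearMap.mem_ker, map_sub, hu2, sub_self]
    obtain ⟨b, hb⟩ := h1
    have h2 : tp Q (f (h z) - z) = 0 := by rw [← hb, ← hom_tp hj, tB, map_zero]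
    rw [map_sub] at h2
    have h3 : tp Q (f (h z)) = 0 := (hom_tp hu z).symm.trans hx
    rw [h3, zero_sub, neg_eq_zero] at h2
    exact hx0 h2
  have usurj := LinearMap.injective_iff_surjective.1 uinj
  exact Function.Surjective.of_comp (g := h) usurj

lemma syz_isCosyzygy {A B : GSupMod k (Fin r)} (h : Syz A B) (tA : ∀ x, tp A x = 0)
    (tB : ∀ x, tp B x = 0) : IsCosyzygy (VCat k r) B A := by
  obtain ⟨Q, j, π, hQ, hc, hj, jinj, hπ, πs, hr⟩ := h
  have hA := vcat_quot hπ πs hQ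
  refine ⟨hA, Q, j, π, ⟨cliff_injective hQ hc, hj, jinj, ?_⟩, hπ, πs, hr.symm⟩
  intro Q2 f hQ2 hf hs
  rw [← LinearMap.ker_eq_bot]
  by_contra hne
  obtain ⟨x, hx, hx0, hxs⟩ := exists_soc hQ _ (ker_inv hf) hne
  obtain ⟨z, rfl⟩ := soc_mem hc _ (List.nodup_finRange r) hxs
  have h1 : pl Q (List.finRange r) z ∈ LinearMap.range j := by
    rw [hr, LinearMap.mem_ker]
    exact (hom_tp hπ z).trans (tA _)
  obtain ⟨b, hb⟩ := h1
  have : b = 0 := by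
    apply hs
    rw [map_zero, LinearMap.comp_apply, hb]; exact hx
  rw [this, map_zero] at hb
  exact hx0 hb.symm

lemma exists_cosyz {B : GSupMod k (Fin r)} (hB : VCat k r B) :
    ∃ A : GSupMod k (Fin r), Syz A B ∧ VCat k r A ∧ ∀ x, tp A x = 0 := by
  obtain ⟨Q, j, hQ, hc, hj, jinj⟩ := hull hB
  obtain ⟨A0, q, hq, qs, qk⟩ := exists_quot Q (LinearMap.range j) (range_inv hj) (range_inv_s hj)
  have hA0 := vcat_quot hq qs hQ
  obtain ⟨C, F, hd, hcF, hF, hC, tC⟩ := decompose hA0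
  obtain ⟨iC, iF, pC, pF, hiC, hiF, hpC, hpF, e1, e2, e3, e4, e5⟩ := isDsum_maps hd
  have hpq := isHom_comp hpF hq
  obtain ⟨s, hs, hs2⟩ := (cliff_projective hF hcF).2 Q F (pF ∘ₗ q) LinearMap.id hQ hF hpq
    (fun x => by
      obtain ⟨y, hy⟩ := qs (iF x)
      exact ⟨y, by simp [hy, e2]⟩) (isHom_id F)
  have hs2' : ∀ x, pF (q (s x)) = x := fun x => LinearMap.congr_fun hs2 x
  obtain ⟨Q', i', hi', iinj', ir'⟩ := exists_sub Q (LinearMap.ker (pF ∘ₗ q)) (ker_inv hpq) (ker_inv_s hpq)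
  have mem : ∀ x, pF (q x) = 0 → x ∈ LinearMap.range i' := fun x hx => by
    rw [ir']; exact hx
  have mem' : ∀ x, pF (q (i' x)) = 0 := fun x => by
    have : i' x ∈ LinearMap.ker (pF ∘ₗ q) := by rw [← ir']; exact ⟨x, rfl⟩
    exact this
  obtain ⟨p', hp', hp2'⟩ := exists_corestrict hi' iinj' (isHom_sub (isHom_id Q) (isHom_comp hs hpq))
    (fun x => mem _ (by simp [hs2']))
  obtain ⟨j', hj', hj2'⟩ := exists_corestrict hi' iinj' hj (fun x => mem _ (by
    have : q (j x) = 0 := by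
      have h : j x ∈ LinearMap.ker q := by rw [qk]; exact ⟨x, rfl⟩
      exact h
    rw [this, map_zero]))
  refine ⟨C, ⟨Q', j', pC ∘ₗ q ∘ₗ i', vcat_sub hi' iinj' hQ,
    cliff_retract hi' hp' (fun x => iinj' ?_) hc, hj', ?_, isHom_comp hpC (isHom_comp hq hi'), ?_, ?_⟩, hC, tC⟩
  · rw [hp2']; simp [mem']
  · intro x y hxy
    apply jinj
    rw [← hj2', hxy, hj2']
  · intro c
    obtain ⟨y, hy⟩ := qs (iC c)
    obtain ⟨z, hz⟩ := mem y (by rw [hy, e3])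
    exact ⟨z, by simp [hz, hy, e1]⟩
  · ext x
    constructor
    · rintro ⟨b, rfl⟩
      have h : j b ∈ LinearMap.ker q := by rw [qk]; exact ⟨b, rfl⟩
      simp [hj2', LinearMap.mem_ker.1 h]
    · intro hx
      have h1 : pC (q (i' x)) = 0 := hx
      have h2 : q (i' x) = 0 := by rw [← e5 (q (i' x)), h1, mem']; simp
      have h3 : i' x ∈ LinearMap.ker q := h2
      rw [qk] at h3
      obtain ⟨b, hb⟩ := h3
      exact ⟨b, iinj' (by rw [hj2', hb])⟩

lemma exists_syz {A : GSupMod k (Fin r)} (hA : VCat k r A) :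
    ∃ B : GSupMod k (Fin r), Syz A B ∧ VCat k r B ∧ ∀ x, tp B x = 0 := by
  obtain ⟨Q, π, hQ, hc, hπ, πs⟩ := cover hA
  obtain ⟨B0, j, hj, jinj, jr⟩ := exists_sub Q (LinearMap.ker π) (ker_inv hπ) (ker_inv_s hπ)
  have hB0 := vcat_sub hj jinj hQ
  obtain ⟨C, F, hd, hcF, hF, hC, tC⟩ := decompose hB0
  obtain ⟨iC, iF, pC, pF, hiC, hiF, hpC, hpF, e1, e2, e3, e4, e5⟩ := isDsum_maps hd
  obtain ⟨ρ, hρ, hρ2⟩ := (cliff_injective hF hcF).2 B0 Q j pF hB0 hQ hj jinj hpF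
  have hρ2' : ∀ x, ρ (j x) = pF x := fun x => LinearMap.congr_fun hρ2 x
  obtain ⟨Q', i', hi', iinj', ir'⟩ := exists_sub Q (LinearMap.ker ρ) (ker_inv hρ) (ker_inv_s hρ)
  have πj : ∀ b, π (j b) = 0 := fun b => by
    have : j b ∈ LinearMap.ker π := by rw [← jr]; exact ⟨b, rfl⟩
    exact this
  have mem : ∀ x, ρ x = 0 → x ∈ LinearMap.range i' := fun x hx => by
    rw [ir']; exact hx
  have mem' : ∀ x, ρ (i' x) = 0 := fun x => by
    have : i' x ∈ LinearMap.ker ρ := by rw [← ir']; exact ⟨x, rfl⟩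
    exact this
  obtain ⟨p', hp', hp2'⟩ := exists_corestrict hi' iinj'
    (isHom_sub (isHom_id Q) (isHom_comp hj (isHom_comp hiF hρ)))
    (fun x => mem _ (by simp [hρ2', e2]))
  obtain ⟨j', hj', hj2'⟩ := exists_corestrict hi' iinj' (isHom_comp hj hiC) (fun x => mem _ (by
    simp [hρ2', e3]))
  refine ⟨C, ⟨Q', j', π ∘ₗ i', vcat_sub hi' iinj' hQ,
    cliff_retract hi' hp' (fun x => iinj' ?_) hc, hj', ?_, isHom_comp hπ hi', ?_, ?_⟩, hC, tC⟩
  · rw [hp2']; simp [mem']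
  · intro x y hxy
    have : j (iC x) = j (iC y) := by
      have h1 := hj2' x
      have h2 := hj2' y
      rw [hxy] at h1
      exact h1.symm.trans h2
    rw [← e1 x, jinj this, e1]
  · intro a
    obtain ⟨x, rfl⟩ := πs a
    exact ⟨p' x, by simp [hp2', πj]⟩
  · ext x
    constructor
    · rintro ⟨b, rfl⟩
      simp [hj2', πj]
    · intro hx
      have h1 : i' x ∈ LinearMap.ker π := hx
      rw [← jr] at h1
      obtain ⟨b, hb⟩ := h1
      have h2 : pF b = 0 := by rw [← hρ2', hb, mem']
      have h3 := e5 b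
      rw [h2, map_zero, add_zero] at h3
      exact ⟨pC b, iinj' (by rw [hj2']; simp [h3, hb])⟩

end syz
end SupCat.EP

end

noncomputable section
set_option linter.unusedSectionVars false
namespace SupCat.EP
open SupCat SupCat.GSupMod
open Module (finrank)
variable {k : Type} [Field k]

section lin
variable {V W : Type} [AddCommGroup V] [Module k V] [FiniteDimensional k V]
  [AddCommGroup W] [Module k W] [FiniteDimensional k W]

lemma finrank_map_add (f : V →ₗ[k] W) (S : Submodule k V) :
    finrank k (S.map f) + finrank k (S ⊓ LinearMap.ker f : Submodule k V) = finrank k S := by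
  have h := LinearMap.finrank_range_add_finrank_ker (f.domRestrict S)
  rw [LinearMap.range_domRestrict, LinearMap.ker_domRestrict] at h
  rw [← h, ← Submodule.finrank_map_subtype_eq S, Submodule.map_comap_subtype]

lemma finrank_map_inj (f : V →ₗ[k] W) (hf : Function.Injective f) (S : Submodule k V) :
    finrank k (S.map f) = finrank k S := by
  have h := finrank_map_add f S
  rw [LinearMap.ker_eq_bot.2 hf, inf_bot_eq, finrank_bot] at h
  simpa using h

lemma semicont_aux (f g : V →ₗ[k] W) :
    {x : k | finrank k (LinearMap.range (f + x • g)) < finrank k (LinearMap.range f)}.Finite := by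
  obtain ⟨s, hs⟩ := f.rangeRestrict.exists_rightInverse_of_surjective
    (LinearMap.range_eq_top.2 f.surjective_rangeRestrict)
  obtain ⟨P, hP⟩ := (LinearMap.range f).subtype.exists_leftInverse_of_injective
    (LinearMap.ker_eq_bot.2 (LinearMap.range f).subtype_injective)
  have hs' : ∀ y : LinearMap.range f, f (s y) = y := fun y =>
    congrArg Subtype.val (LinearMap.congr_fun hs y)
  have hP' : ∀ y : LinearMap.range f, P y = y := fun y => LinearMap.congr_fun hP y
  let N : Module.End k (LinearMap.range f) := P ∘ₗ g ∘ₗ s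
  have hfin : {μ : k | N.HasEigenvalue μ}.Finite := N.finite_hasEigenvalue
  refine (hfin.preimage (f := fun x : k => -x⁻¹) (Function.Injective.injOn
    (neg_injective.comp inv_injective))).subset ?_
  intro x hx
  by_contra hne
  apply absurd hx
  simp only [Set.mem_setOf_eq, not_lt]
  have hinj : Function.Injective ((f + x • g) ∘ₗ s) := by
    rw [← LinearMap.ker_eq_bot, LinearMap.ker_eq_bot']
    intro y hy
    by_contra hy0
    apply hne
    have h1 : y + x • N y = 0 := by
      have h2 : P ((f + x • g) (s y)) = 0 := by
        have : (f + x • g) (s y) = 0 := hy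
        rw [this, map_zero]
      rw [LinearMap.add_apply, map_add, hs', hP', LinearMap.smul_apply, map_smul] at h2
      exact h2
    have hx0 : x ≠ 0 := by
      rintro rfl
      rw [zero_smul, add_zero] at h1
      exact hy0 h1
    refine Module.End.hasEigenvalue_of_hasEigenvector (x := y) ⟨?_, hy0⟩
    rw [Module.End.mem_eigenspace_iff]
    have h3 : x • N y = - y := eq_neg_of_add_eq_zero_right h1
    rw [neg_smul, ← smul_neg, ← h3, smul_smul, inv_mul_cancel₀ hx0, one_smul]
  calc finrank k (LinearMap.range f) = finrank k (LinearMap.range ((f + x • g) ∘ₗ s)) :=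
        (LinearMap.finrank_range_of_inj hinj).symm
    _ ≤ _ := Submodule.finrank_mono (LinearMap.range_comp_le_range _ _)

lemma semicont (S : Submodule k V) (f g : V →ₗ[k] W) :
    {x : k | finrank k (S.map (f + x • g)) < finrank k (S.map f)}.Finite := by
  have h := semicont_aux (f.domRestrict S) (g.domRestrict S)
  refine h.subset fun x hx => ?_
  simp only [Set.mem_setOf_eq] at *
  have : f.domRestrict S + x • g.domRestrict S = (f + x • g).domRestrict S := rfl
  rw [this, LinearMap.range_domRestrict, LinearMap.range_domRestrict]
  exact hx

end lin

variable [CharZero k]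
section num
variable {r : ℕ}

lemma act_apply (M : GSupMod k (Fin r)) (v : Fin r → k) (x : M.carrier) :
    actOf M v x = ∑ i, v i • M.θ i x := by simp [actOf]

lemma hom_act {M N : GSupMod k (Fin r)} {f : M.carrier →ₗ[k] N.carrier} (hf : IsHom M N f)
    (v : Fin r → k) (x : M.carrier) : f (actOf M v x) = actOf N v (f x) := by
  rw [isHom_iff] at hf
  simp [act_apply, hf.1]

lemma act_ev (M : GSupMod k (Fin r)) (v : Fin r → k) {x : M.carrier} (hx : x ∈ M.ev) :
    actOf M v x ∈ M.od := by
  rw [act_apply]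
  exact Submodule.sum_mem _ fun i _ => Submodule.smul_mem _ _ (M.θ_ev i x hx)

lemma act_od (M : GSupMod k (Fin r)) (v : Fin r → k) {x : M.carrier} (hx : x ∈ M.od) :
    actOf M v x ∈ M.ev := by
  rw [act_apply]
  exact Submodule.sum_mem _ fun i _ => Submodule.smul_mem _ _ (M.θ_od i x hx)

lemma act_act {M : GSupMod k (Fin r)} (hM : VCat k r M) (v w : Fin r → k) (x : M.carrier) :
    actOf M v (actOf M w x) = - actOf M w (actOf M v x) := by
  simp only [act_apply, map_sum, map_smul, Finset.smul_sum]
  rw [Finset.sum_comm, ← Finset.sum_neg_distrib]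
  refine Finset.sum_congr rfl fun i _ => ?_
  rw [← Finset.sum_neg_distrib]
  refine Finset.sum_congr rfl fun j _ => ?_
  rw [ac hM j i, smul_neg, smul_neg, smul_comm, neg_neg]

lemma act_sq {M : GSupMod k (Fin r)} (hM : VCat k r M) (v : Fin r → k) (x : M.carrier) :
    actOf M v (actOf M v x) = 0 := self_eq_neg_k (k := k) (act_act hM v v x)

lemma act_add (M : GSupMod k (Fin r)) (v w : Fin r → k) (c : k) :
    actOf M (v + c • w) = actOf M v + c • actOf M w := by
  ext x
  simp [act_apply, add_smul, Finset.sum_add_distrib, Finset.smul_sum, smul_smul]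

/-- dimension of the even part -/
def nE (M : GSupMod k (Fin r)) : ℕ := finrank k M.ev
/-- dimension of the odd part -/
def nO (M : GSupMod k (Fin r)) : ℕ := finrank k M.od
/-- rank on the even part -/
def na (M : GSupMod k (Fin r)) (v : Fin r → k) : ℕ := finrank k (M.ev.map (actOf M v))
/-- rank on the odd part -/
def nb (M : GSupMod k (Fin r)) (v : Fin r → k) : ℕ := finrank k (M.od.map (actOf M v))

lemma nE_add_nO (M : GSupMod k (Fin r)) : nE M + nO M = finrank k M.carrier :=
  Submodule.finrank_add_eq_of_isCompl M.isCompl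

lemma na_ker (M : GSupMod k (Fin r)) (v : Fin r → k) :
    na M v + finrank k (M.ev ⊓ LinearMap.ker (actOf M v) : Submodule k M.carrier) = nE M :=
  finrank_map_add _ _
lemma nb_ker (M : GSupMod k (Fin r)) (v : Fin r → k) :
    nb M v + finrank k (M.od ⊓ LinearMap.ker (actOf M v) : Submodule k M.carrier) = nO M :=
  finrank_map_add _ _

lemma map_od_le {M : GSupMod k (Fin r)} (hM : VCat k r M) (v : Fin r → k) :
    M.od.map (actOf M v) ≤ M.ev ⊓ LinearMap.ker (actOf M v) := by
  rintro _ ⟨x, hx, rfl⟩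
  exact ⟨act_od M v hx, act_sq hM v x⟩
lemma map_ev_le {M : GSupMod k (Fin r)} (hM : VCat k r M) (v : Fin r → k) :
    M.ev.map (actOf M v) ≤ M.od ⊓ LinearMap.ker (actOf M v) := by
  rintro _ ⟨x, hx, rfl⟩
  exact ⟨act_ev M v hx, act_sq hM v x⟩

lemma ab_le_E {M : GSupMod k (Fin r)} (hM : VCat k r M) (v : Fin r → k) : na M v + nb M v ≤ nE M := by
  rw [← na_ker M v]
  exact Nat.add_le_add_left (Submodule.finrank_mono (map_od_le hM v)) _
lemma ab_le_O {M : GSupMod k (Fin r)} (hM : VCat k r M) (v : Fin r → k) : na M v + nb M v ≤ nO M := by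
  rw [← nb_ker M v, add_comm]
  exact Nat.add_le_add_left (Submodule.finrank_mono (map_ev_le hM v)) _

lemma rank_eq (M : GSupMod k (Fin r)) (v : Fin r → k) :
    finrank k (LinearMap.range (actOf M v)) = na M v + nb M v := by
  rw [LinearMap.range_eq_map, ← M.isCompl.sup_eq_top, Submodule.map_sup]
  have h := Submodule.finrank_sup_add_finrank_inf_eq (M.ev.map (actOf M v)) (M.od.map (actOf M v))
  have h2 : M.ev.map (actOf M v) ⊓ M.od.map (actOf M v) = ⊥ := by
    rw [eq_bot_iff]
    rintro x ⟨⟨y, hy, rfl⟩, ⟨z, hz, hx⟩⟩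
    have h3 := act_ev M v hy
    have h4 := act_od M v hz
    rw [hx] at h4
    exact Submodule.disjoint_def.1 M.isCompl.disjoint _ h4 h3
  rw [h2, finrank_bot, add_zero] at h
  exact h

/-- one-dimensional homology for each nonzero odd element -/
def Good (M : GSupMod k (Fin r)) : Prop := ∀ v : Fin r → k, v ≠ 0 → nE M + nO M = 2 * (na M v + nb M v) + 1

lemma na_const {M : GSupMod k (Fin r)} (hg : Good M) (v w : Fin r → k) (hv : v ≠ 0) (hw : w ≠ 0) :
    na M v = na M w := by
  suffices H : ∀ v w : Fin r → k, v ≠ 0 → w ≠ 0 → na M v ≤ na M w from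
    le_antisymm (H v w hv hw) (H w v hw hv)
  intro v w hv hw
  have s1 := semicont M.ev (actOf M v) (actOf M w)
  have s2 := semicont M.od (actOf M w) (actOf M v)
  have s3 := s2.preimage (f := fun x : k => x⁻¹) inv_injective.injOn
  have s4 : {x : k | v + x • w = 0}.Subsingleton := by
    intro x hx y hy
    have h : (x - y) • w = 0 := by
      rw [sub_smul, sub_eq_zero]
      exact add_left_cancel (hx.trans hy.symm)
    exact sub_eq_zero.1 ((smul_eq_zero.1 h).resolve_right hw)
  obtain ⟨x, hx⟩ := (((s1.union s3).union s4.finite).union (Set.finite_singleton (0 : k))).exists_notMem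
  simp only [Set.mem_union, not_or, Set.mem_setOf_eq, Set.mem_preimage, Set.mem_singleton_iff, not_lt] at hx
  obtain ⟨⟨⟨h1, h2⟩, h3⟩, h4⟩ := hx
  rw [← act_add] at h1
  have h5 : M.od.map (actOf M w + x⁻¹ • actOf M v) = M.od.map (actOf M (v + x • w)) := by
    have : actOf M (v + x • w) = x • (actOf M w + x⁻¹ • actOf M v) := by
      rw [act_add, smul_add, smul_smul, mul_inv_cancel₀ h4, one_smul, add_comm]
    rw [this, Submodule.map_smul _ _ _ h4]
  rw [h5] at h2
  have g1 := hg _ h3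
  have g2 := hg _ hw
  simp only [na, nb] at *
  omega

lemma dsum_finrank {A B S : Type} [AddCommGroup A] [Module k A] [FiniteDimensional k A]
    [AddCommGroup B] [Module k B] [FiniteDimensional k B] [AddCommGroup S] [Module k S] [FiniteDimensional k S]
    {iA : A →ₗ[k] S} {iB : B →ₗ[k] S} {pA : S →ₗ[k] A} {pB : S →ₗ[k] B}
    (h1 : ∀ a, pA (iA a) = a) (h2 : ∀ b, pB (iB b) = b) (h3 : ∀ a, pB (iA a) = 0)
    (X : Submodule k A) (Y : Submodule k B) :
    finrank k (X.map iA ⊔ Y.map iB : Submodule k S) = finrank k X + finrank k Y := by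
  have h := Submodule.finrank_sup_add_finrank_inf_eq (X.map iA) (Y.map iB)
  have hz : X.map iA ⊓ Y.map iB = ⊥ := by
    rw [eq_bot_iff]
    rintro x ⟨⟨y, hy, rfl⟩, ⟨z, hz, hx⟩⟩
    have : z = 0 := by rw [← h2 z, hx, h3]
    rw [this, map_zero] at hx
    exact hx.symm
  rw [hz, finrank_bot, add_zero, finrank_map_inj iA (Function.LeftInverse.injective h1),
    finrank_map_inj iB (Function.LeftInverse.injective h2)] at h
  exact h

lemma dsum_num {A B S : GSupMod k (Fin r)} (h : IsDsum A B S) :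
    nE S = nE A + nE B ∧ nO S = nO A + nO B ∧ ∀ v, na S v = na A v + na B v ∧ nb S v = nb A v + nb B v := by
  obtain ⟨iA, iB, pA, pB, hiA, hiB, hpA, hpB, e1, e2, e3, e4, e5⟩ := isDsum_maps h
  have hev : S.ev = A.ev.map iA ⊔ B.ev.map iB := by
    apply le_antisymm
    · intro x hx
      rw [← e5 x]
      exact Submodule.add_mem_sup ⟨_, hpA.2.1 x hx, rfl⟩ ⟨_, hpB.2.1 x hx, rfl⟩
    · rw [sup_le_iff]
      constructor
      · rintro _ ⟨x, hx, rfl⟩; exact hiA.2.1 x hx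
      · rintro _ ⟨x, hx, rfl⟩; exact hiB.2.1 x hx
  have hod : S.od = A.od.map iA ⊔ B.od.map iB := by
    apply le_antisymm
    · intro x hx
      rw [← e5 x]
      exact Submodule.add_mem_sup ⟨_, hpA.2.2 x hx, rfl⟩ ⟨_, hpB.2.2 x hx, rfl⟩
    · rw [sup_le_iff]
      constructor
      · rintro _ ⟨x, hx, rfl⟩; exact hiA.2.2 x hx
      · rintro _ ⟨x, hx, rfl⟩; exact hiB.2.2 x hx
  have hmA : ∀ v (X : Submodule k A.carrier), (X.map iA).map (actOf S v) = (X.map (actOf A v)).map iA := by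
    intro v X
    rw [← Submodule.map_comp, ← Submodule.map_comp]
    congr 1
    ext x; simp [hom_act hiA]
  have hmB : ∀ v (X : Submodule k B.carrier), (X.map iB).map (actOf S v) = (X.map (actOf B v)).map iB := by
    intro v X
    rw [← Submodule.map_comp, ← Submodule.map_comp]
    congr 1
    ext x; simp [hom_act hiB]
  refine ⟨?_, ?_, fun v => ⟨?_, ?_⟩⟩
  · rw [nE, hev, dsum_finrank e1 e2 e3]; rfl
  · rw [nO, hod, dsum_finrank e1 e2 e3]; rfl
  · rw [na, hev, Submodule.map_sup, hmA, hmB, dsum_finrank e1 e2 e3]; rfl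
  · rw [nb, hod, Submodule.map_sup, hmA, hmB, dsum_finrank e1 e2 e3]; rfl

lemma cliff_contr {M : GSupMod k (Fin r)} (hc : Cliff M) (c : Fin r → k) :
    ∃ d : M.carrier →ₗ[k] M.carrier, (∀ v x, d (actOf M v x) + actOf M v (d x) = (∑ i, c i * v i) • x) ∧
      (∀ x ∈ M.ev, d x ∈ M.od) ∧ (∀ x ∈ M.od, d x ∈ M.ev) := by
  obtain ⟨d, hd⟩ := hc
  have hs : ∀ x, M.sigma ((∑ i, c i • d i) x) = - (∑ i, c i • d i) (M.sigma x) := by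
    intro x
    simp only [LinearMap.sum_apply, LinearMap.smul_apply, map_sum, map_smul, ← Finset.sum_neg_distrib]
    refine Finset.sum_congr rfl fun i _ => ?_
    rw [(hd i (Finset.mem_univ _)).2, smul_neg]
  refine ⟨∑ i, c i • d i, fun v x => ?_, fun x hx => ?_, fun x hx => ?_⟩
  · simp only [act_apply, LinearMap.sum_apply, LinearMap.smul_apply, map_sum, map_smul, Finset.smul_sum]
    rw [Finset.sum_comm, ← Finset.sum_add_distrib, Finset.sum_smul]
    refine Finset.sum_congr rfl fun i _ => ?_
    rw [← Finset.sum_add_distrib, Finset.sum_eq_single i]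
    · have := (hd i (Finset.mem_univ _)).1 i x
      rw [if_pos rfl] at this
      rw [smul_comm (c i) (v i), ← smul_add, ← smul_add, this, smul_smul, mul_comm]
    · intro j _ hj
      have := (hd i (Finset.mem_univ _)).1 j x
      rw [if_neg (Ne.symm hj)] at this
      rw [smul_comm (c i) (v j), ← smul_add, ← smul_add, this]; simp
    · simp
  · rw [mem_od_iff, hs, sigma_ev M hx]
  · rw [mem_ev_iff, hs, sigma_od M hx, map_neg, neg_neg]

lemma cliff_num {M : GSupMod k (Fin r)} (hM : VCat k r M) (hc : Cliff M) (v : Fin r → k) (hv : v ≠ 0) :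
    nE M = na M v + nb M v ∧ nO M = na M v + nb M v ∧
    M.ev ⊓ LinearMap.ker (actOf M v) = M.od.map (actOf M v) ∧
    M.od ⊓ LinearMap.ker (actOf M v) = M.ev.map (actOf M v) := by
  obtain ⟨p, hp⟩ := Function.ne_iff.1 hv
  simp only [Pi.zero_apply] at hp
  obtain ⟨d, h1, h2, h3⟩ := cliff_contr hc (Pi.single p (v p)⁻¹)
  have hone : ∑ i, (Pi.single p (v p)⁻¹ : Fin r → k) i * v i = 1 := by
    rw [Finset.sum_eq_single p]
    · simp [hp]
    · intro j _ hj; simp [hj]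
    · simp
  have key : ∀ x, actOf M v x = 0 → x = actOf M v (d x) := by
    intro x hx
    have := h1 v x
    rw [hone, hx, map_zero, zero_add, one_smul] at this
    exact this.symm
  have e1 : M.ev ⊓ LinearMap.ker (actOf M v) = M.od.map (actOf M v) := by
    refine le_antisymm ?_ (map_od_le hM v)
    rintro x ⟨hx, hx2⟩
    exact ⟨d x, h2 x hx, (key x hx2).symm⟩
  have e2 : M.od ⊓ LinearMap.ker (actOf M v) = M.ev.map (actOf M v) := by
    refine le_antisymm ?_ (map_ev_le hM v)
    rintro x ⟨hx, hx2⟩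
    exact ⟨d x, h3 x hx, (key x hx2).symm⟩
  refine ⟨?_, ?_, e1, e2⟩
  · rw [← na_ker M v, e1]; rfl
  · rw [← nb_ker M v, e2, add_comm]; rfl

lemma cliff_ab {M : GSupMod k (Fin r)} (hM : VCat k r M) (hc : Cliff M) (hr : 2 ≤ r) (v : Fin r → k)
    (hv : v ≠ 0) : na M v = nb M v := by
  obtain ⟨p, hp⟩ := Function.ne_iff.1 hv
  simp only [Pi.zero_apply] at hp
  obtain ⟨q, hq⟩ : ∃ q : Fin r, q ≠ p := by
    have : Nontrivial (Fin r) := Fin.nontrivial_iff_two_le.2 hr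
    exact exists_ne p
  obtain ⟨d, h1, h2, h3⟩ := cliff_contr hc (Pi.single q 1 - Pi.single p (v q / v p))
  have c1 : ∑ i, (Pi.single q 1 - Pi.single p (v q / v p) : Fin r → k) i * v i = 0 := by
    simp [sub_mul, Finset.sum_sub_distrib, Pi.single_apply, hp]
  have c2 : ∑ i, (Pi.single q 1 - Pi.single p (v q / v p) : Fin r → k) i * (Pi.single q 1 : Fin r → k) i = 1 := by
    simp [sub_mul, Finset.sum_sub_distrib, Pi.single_apply, hq]
  set w : Fin r → k := Pi.single q 1 with hw
  have k1 : ∀ x, d (actOf M v x) = - actOf M v (d x) := fun x => by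
    have := h1 v x
    rw [c1, zero_smul] at this
    exact eq_neg_of_add_eq_zero_left this
  have k2 : ∀ x, actOf M w x = 0 → x = actOf M w (d x) := by
    intro x hx
    have := h1 w x
    rw [c2, hx, map_zero, zero_add, one_smul] at this
    exact this.symm
  have e1 : M.ev.map (actOf M v) ⊓ LinearMap.ker (actOf M w) = (M.od.map (actOf M v)).map (actOf M w) := by
    apply le_antisymm
    · rintro _ ⟨⟨x, hx, rfl⟩, hx2⟩
      refine ⟨d (actOf M v x), ⟨- d x, neg_mem (h2 x hx), ?_⟩, (k2 _ hx2).symm⟩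
      rw [k1, map_neg]
    · rintro _ ⟨_, ⟨x, hx, rfl⟩, rfl⟩
      refine ⟨⟨- actOf M w x, neg_mem (act_od M w hx), ?_⟩, act_sq hM w _⟩
      rw [act_act hM w v, map_neg]
  have e2 : M.od.map (actOf M v) ⊓ LinearMap.ker (actOf M w) = (M.ev.map (actOf M v)).map (actOf M w) := by
    apply le_antisymm
    · rintro _ ⟨⟨x, hx, rfl⟩, hx2⟩
      refine ⟨d (actOf M v x), ⟨- d x, neg_mem (h3 x hx), ?_⟩, (k2 _ hx2).symm⟩
      rw [k1, map_neg]
    · rintro _ ⟨_, ⟨x, hx, rfl⟩, rfl⟩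
      refine ⟨⟨- actOf M w x, neg_mem (act_ev M w hx), ?_⟩, act_sq hM w _⟩
      rw [act_act hM w v, map_neg]
  have f1 := finrank_map_add (actOf M w) (M.ev.map (actOf M v))
  have f2 := finrank_map_add (actOf M w) (M.od.map (actOf M v))
  rw [e1] at f1
  rw [e2] at f2
  simp only [na, nb]
  omega

lemma syz_num {A B : GSupMod k (Fin r)} (h : Syz A B) (hr : 2 ≤ r) (v : Fin r → k) (hv : v ≠ 0) :
    ∃ c, nE A + nE B = 2 * c ∧ nO A + nO B = 2 * c ∧ na A v + nO B = c + nb B v ∧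
      nb A v + nE B = c + na B v := by
  obtain ⟨Q, j, π, hQ, hc, hj, jinj, hπ, πs, hr'⟩ := h
  obtain ⟨q1, q2, q3, q4⟩ := cliff_num hQ hc v hv
  have q5 := cliff_ab hQ hc hr v hv
  have mev : Q.ev.map π = A.ev := by
    apply le_antisymm
    · rintro _ ⟨x, hx, rfl⟩; exact hπ.2.1 x hx
    · intro y hy
      obtain ⟨x, rfl⟩ := πs y
      obtain ⟨x1, h1, x2, h2, rfl⟩ := decomp Q x
      have h3 : π x2 = 0 := by
        refine Submodule.disjoint_def.1 A.isCompl.disjoint _ ?_ (hπ.2.2 x2 h2)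
        have : π x2 = π (x1 + x2) - π x1 := by simp
        rw [this]
        exact sub_mem hy (hπ.2.1 x1 h1)
      exact ⟨x1, h1, by rw [map_add, h3, add_zero]⟩
  have mod : Q.od.map π = A.od := by
    apply le_antisymm
    · rintro _ ⟨x, hx, rfl⟩; exact hπ.2.2 x hx
    · intro y hy
      obtain ⟨x, rfl⟩ := πs y
      obtain ⟨x1, h1, x2, h2, rfl⟩ := decomp Q x
      have h3 : π x1 = 0 := by
        refine Submodule.disjoint_def.1 A.isCompl.disjoint _ (hπ.2.1 x1 h1) ?_
        have : π x1 = π (x1 + x2) - π x2 := by simp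
        rw [this]
        exact sub_mem hy (hπ.2.2 x2 h2)
      exact ⟨x2, h2, by rw [map_add, h3, zero_add]⟩
  have jev : ∀ b, j b ∈ Q.ev ↔ b ∈ B.ev := fun b => by
    rw [mem_ev_iff, mem_ev_iff, ← ((isHom_iff _ _ _).1 hj).2, jinj.eq_iff]
  have jod : ∀ b, j b ∈ Q.od ↔ b ∈ B.od := fun b => by
    rw [mem_od_iff, mem_od_iff, ← ((isHom_iff _ _ _).1 hj).2, ← map_neg, jinj.eq_iff]
  have kev : Q.ev ⊓ LinearMap.ker π = B.ev.map j := by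
    rw [← hr']
    apply le_antisymm
    · rintro _ ⟨h, ⟨b, rfl⟩⟩; exact ⟨b, (jev b).1 h, rfl⟩
    · rintro _ ⟨b, hb, rfl⟩; exact ⟨(jev b).2 hb, ⟨b, rfl⟩⟩
  have kod : Q.od ⊓ LinearMap.ker π = B.od.map j := by
    rw [← hr']
    apply le_antisymm
    · rintro _ ⟨h, ⟨b, rfl⟩⟩; exact ⟨b, (jod b).1 h, rfl⟩
    · rintro _ ⟨b, hb, rfl⟩; exact ⟨(jod b).2 hb, ⟨b, rfl⟩⟩
  have jk : ∀ b, actOf Q v (j b) = 0 ↔ actOf B v b = 0 := fun b => by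
    rw [← hom_act hj]
    exact ⟨fun h => jinj (h.trans (map_zero j).symm), fun h => by rw [h, map_zero]⟩
  have kev2 : Q.ev.map (actOf Q v) ⊓ LinearMap.ker π = (B.od ⊓ LinearMap.ker (actOf B v)).map j := by
    rw [← q4, ← hr']
    apply le_antisymm
    · rintro _ ⟨⟨h, h2⟩, ⟨b, rfl⟩⟩; exact ⟨b, ⟨(jod b).1 h, (jk b).1 h2⟩, rfl⟩
    · rintro _ ⟨b, ⟨hb, hb2⟩, rfl⟩; exact ⟨⟨(jod b).2 hb, (jk b).2 hb2⟩, ⟨b, rfl⟩⟩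
  have kod2 : Q.od.map (actOf Q v) ⊓ LinearMap.ker π = (B.ev ⊓ LinearMap.ker (actOf B v)).map j := by
    rw [← q3, ← hr']
    apply le_antisymm
    · rintro _ ⟨⟨h, h2⟩, ⟨b, rfl⟩⟩; exact ⟨b, ⟨(jev b).1 h, (jk b).1 h2⟩, rfl⟩
    · rintro _ ⟨b, ⟨hb, hb2⟩, rfl⟩; exact ⟨⟨(jev b).2 hb, (jk b).2 hb2⟩, ⟨b, rfl⟩⟩
  have hcomm : ∀ X : Submodule k Q.carrier, (X.map (actOf Q v)).map π = (X.map π).map (actOf A v) := by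
    intro X
    rw [← Submodule.map_comp, ← Submodule.map_comp]
    congr 1
    ext x; simp [hom_act hπ]
  have f1 := finrank_map_add π Q.ev
  have f2 := finrank_map_add π Q.od
  have f3 := finrank_map_add π (Q.ev.map (actOf Q v))
  have f4 := finrank_map_add π (Q.od.map (actOf Q v))
  rw [mev, kev, finrank_map_inj j jinj] at f1
  rw [mod, kod, finrank_map_inj j jinj] at f2
  rw [hcomm, mev, kev2, finrank_map_inj j jinj] at f3
  rw [hcomm, mod, kod2, finrank_map_inj j jinj] at f4
  have f5 := na_ker B v
  have f6 := nb_ker B v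
  refine ⟨na Q v, ?_⟩
  simp only [nE, nO, na, nb] at *
  omega

end num
end SupCat.EP

end

noncomputable section
set_option linter.unusedSectionVars false
namespace SupCat.EP
open SupCat SupCat.GSupMod
open Module (finrank)
variable {k : Type} [Field k]

lemma homology_one {V : Type} [AddCommGroup V] [Module k V] [FiniteDimensional k V]
    (d s : V →ₗ[k] V) (hd : ∀ x, d (d x) = 0) (hs : ∀ x, s (d x) = - d (s x))
    (D : (V →ₗ[k] V) →ₗ[k] (V →ₗ[k] V)) (hD : ∀ h, D h = d ∘ₗ h - (s ∘ₗ h ∘ₗ s) ∘ₗ d)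
    (hDD : ∀ h, D (D h) = 0)
    (hr : finrank k (V →ₗ[k] V) = 2 * finrank k (LinearMap.range D) + 1) :
    finrank k V = 2 * finrank k (LinearMap.range d) + 1 := by
  have hle : LinearMap.range d ≤ LinearMap.ker d := by
    rintro _ ⟨x, rfl⟩; exact hd x
  obtain ⟨C, hC⟩ := Submodule.exists_isCompl (LinearMap.range d)
  let X : Submodule k V := LinearMap.ker d ⊓ C
  have hXd : Disjoint (LinearMap.range d) X := hC.disjoint.mono_right inf_le_right
  have hXs : LinearMap.range d ⊔ X = LinearMap.ker d := by
    show LinearMap.range d ⊔ LinearMap.ker d ⊓ C = LinearMap.ker d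
    rw [inf_comm, ← sup_inf_assoc_of_le C hle, hC.sup_eq_top, top_inf_eq]
  have hdim : finrank k (LinearMap.range d) + finrank k X = finrank k (LinearMap.ker d) := by
    have := Submodule.finrank_sup_add_finrank_inf_eq (LinearMap.range d) X
    rw [hXs, hXd.eq_bot, finrank_bot] at this
    omega
  have hrn := LinearMap.finrank_range_add_finrank_ker d
  obtain ⟨Y, hY1, hY2⟩ := Submodule.exists_isCompl (LinearMap.range d ⊔ X)
  have hc : IsCompl X (LinearMap.range d ⊔ Y) := by
    constructor
    · rw [Submodule.disjoint_def] at *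
      intro x hx hx2
      obtain ⟨b, hb, y, hy, rfl⟩ := Submodule.mem_sup.1 hx2
      have : y = 0 := by
        apply hY1 y ?_ hy
        have e : y = -b + (b + y) := by abel
        rw [e]
        exact Submodule.add_mem_sup (neg_mem hb) hx
      rw [this, add_zero] at hx ⊢
      exact hXd b hb hx
    · rw [codisjoint_iff, ← sup_assoc, sup_comm X]
      exact hY2.eq_top
  let q : V →ₗ[k] X := Submodule.projectionOnto _ _ hc
  have q1 : ∀ x : X, q x = x := fun x => Submodule.projectionOnto_apply_left hc x
  have q2 : ∀ x, q (d x) = 0 := fun x =>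
    (Submodule.projectionOnto_apply_eq_zero_iff hc).2 (Submodule.mem_sup_left ⟨x, rfl⟩)
  have q3 : ∀ x : X, d x = 0 := fun x => x.2.1
  let Φ : (X →ₗ[k] X) →ₗ[k] (V →ₗ[k] V) :=
    { toFun := fun f => X.subtype ∘ₗ f ∘ₗ q
      map_add' := fun f g => by ext; simp
      map_smul' := fun c f => by ext; simp }
  have hΦ : ∀ f x, Φ f x = (f (q x) : V) := fun f x => rfl
  have hinj : ∀ f g, Φ f = D g → f = 0 := by
    intro f g h
    ext x
    have h1 : f x = q (Φ f x) := by rw [hΦ, q1, q1]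
    rw [h1, h, hD]
    simp only [LinearMap.sub_apply, LinearMap.comp_apply, map_sub, q2, q3, map_zero, sub_zero, LinearMap.zero_apply]
  have hΦi : Function.Injective Φ := by
    rw [← LinearMap.ker_eq_bot, LinearMap.ker_eq_bot']
    intro f hf
    exact hinj f 0 (by rw [hf, map_zero])
  have hlt : LinearMap.range Φ ⊔ LinearMap.range D ≤ LinearMap.ker D := by
    rw [sup_le_iff]
    constructor
    · rintro _ ⟨f, rfl⟩
      rw [LinearMap.mem_ker, hD]
      ext x
      simp [hΦ, q3, hs, q2]
    · rintro _ ⟨f, rfl⟩; exact hDD f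
  have hdis : LinearMap.range Φ ⊓ LinearMap.range D = ⊥ := by
    rw [eq_bot_iff]
    rintro _ ⟨⟨f, rfl⟩, ⟨g, hg⟩⟩
    rw [hinj f g hg.symm, map_zero]; exact zero_mem _
  have f1 := Submodule.finrank_sup_add_finrank_inf_eq (LinearMap.range Φ) (LinearMap.range D)
  have f2 := Submodule.finrank_mono hlt
  have f3 := LinearMap.finrank_range_add_finrank_ker D
  rw [hdis, finrank_bot, LinearMap.finrank_range_of_inj hΦi, Module.finrank_linearMap] at f1
  have f4 : finrank k X * finrank k X ≤ 1 := by omega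
  rw [Module.finrank_linearMap] at f3 hr
  have f5 : finrank k X ≤ 1 := by nlinarith
  have f6 : Odd (finrank k V * finrank k V) := ⟨_, hr⟩
  have f7 : Odd (finrank k V) := (Nat.odd_mul.1 f6).1
  obtain ⟨m, hm⟩ := f7
  omega

variable [CharZero k] {r : ℕ}

lemma dsum_iso {A B S H : GSupMod k (Fin r)} (h : IsDsum A B S) (e : Iso H S) : IsDsum A B H := by
  obtain ⟨φ, h1, h2, h3⟩ := h
  obtain ⟨e, he⟩ := e
  have he' := (isHom_iff _ _ _).1 he
  refine ⟨e.trans φ, fun x => ?_, fun x => ?_, fun i x => ?_⟩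
  · rw [LinearEquiv.trans_apply, ← h1, mem_ev_iff, mem_ev_iff]
    have := he'.2 x
    simp only [LinearEquiv.coe_coe] at this
    rw [← this, e.injective.eq_iff]
  · rw [LinearEquiv.trans_apply, ← h2, mem_od_iff, mem_od_iff]
    have := he'.2 x
    simp only [LinearEquiv.coe_coe] at this
    rw [← this, ← map_neg, e.injective.eq_iff]
  · rw [LinearEquiv.trans_apply, LinearEquiv.trans_apply, ← h3]
    have := he'.1 i x
    simp only [LinearEquiv.coe_coe] at this
    rw [← this]

lemma sigma_act (M : GSupMod k (Fin r)) (v : Fin r → k) (x : M.carrier) :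
    M.sigma (actOf M v x) = - actOf M v (M.sigma x) := by
  simp [act_apply, sigma_θ]

lemma good_of_endo {M : GSupMod k (Fin r)} (hE : IsEndotrivial (VCat k r) M) : Good M := by
  obtain ⟨hM, H, K, P, S, ⟨φ, -, -, hφ⟩, hH, hK, hP, hS, hI⟩ := hE
  intro v hv
  have hd := dsum_num (dsum_iso hS hI)
  have hPc := cliff_num hP.1 (projective_cliff hP) v hv
  have hKa : actOf K v = 0 := by ext x; simp [act_apply, hK.2.1]
  have hna : na K v = 0 := by simp [na, hKa]
  have hnb : nb K v = 0 := by simp [nb, hKa]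
  have hKf := nE_add_nO K
  rw [hK.1] at hKf
  have hHf := nE_add_nO H
  have hHr := rank_eq H v
  obtain ⟨d1, d2, d3⟩ := hd
  obtain ⟨d3, d4⟩ := d3 v
  have key : finrank k H.carrier = 2 * finrank k (LinearMap.range (actOf H v)) + 1 := by omega
  rw [nE_add_nO, ← rank_eq]
  let D := φ.conj (actOf H v)
  have hDa : ∀ h, D h = φ (actOf H v (φ.symm h)) := fun h => rfl
  refine homology_one (actOf M v) M.sigma (act_sq hM v) (sigma_act M v) D ?_ ?_ ?_
  · intro h
    obtain ⟨h, rfl⟩ := φ.surjective h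
    rw [hDa, φ.symm_apply_apply, act_apply, map_sum]
    simp only [map_smul, hφ]
    ext x
    simp [act_apply, smul_sub, Finset.sum_sub_distrib]
  · intro h
    rw [hDa, hDa, φ.symm_apply_apply, act_sq hH, map_zero]
  · rw [← LinearEquiv.finrank_eq φ, key]
    congr 2
    have : LinearMap.range D = (LinearMap.range (actOf H v)).map (φ : H.carrier →ₗ[k] _) := by
      ext y
      constructor
      · rintro ⟨x, rfl⟩
        exact ⟨_, ⟨φ.symm x, rfl⟩, rfl⟩
      · rintro ⟨_, ⟨x, rfl⟩, rfl⟩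
        exact ⟨φ x, by rw [hDa, φ.symm_apply_apply]; rfl⟩
    rw [this, LinearEquiv.finrank_map_eq]

end SupCat.EP

end

noncomputable section
set_option linter.unusedSectionVars false
namespace SupCat.EP
open SupCat SupCat.GSupMod
open Module (finrank)
variable {k : Type} [Field k]

lemma pencil [IsAlgClosed k] {V : Type} [AddCommGroup V] [Module k V] [FiniteDimensional k V]
    (f g : V →ₗ[k] V) (X R : Submodule k V) (hf : X.map f = R) (hg : X.map g ≤ R)
    (hk : ∀ c : k, ∀ x ∈ X, g x = c • f x → f x = 0) : R = ⊥ := by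
  by_contra hne
  have hfR : ∀ x : X, f x ∈ R := fun x => hf ▸ ⟨x, x.2, rfl⟩
  have hgR : ∀ x : X, g x ∈ R := fun x => hg ⟨x, x.2, rfl⟩
  let f' : X →ₗ[k] R := (f.domRestrict X).codRestrict R hfR
  let g' : X →ₗ[k] R := (g.domRestrict X).codRestrict R hgR
  have hsurj : Function.Surjective f' := by
    rintro ⟨y, hy⟩
    rw [← hf] at hy
    obtain ⟨x, hx, rfl⟩ := hy
    exact ⟨⟨x, hx⟩, rfl⟩
  obtain ⟨s, hs⟩ := f'.exists_rightInverse_of_surjective (LinearMap.range_eq_top.2 hsurj)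
  have hs' : ∀ y : R, f (s y) = y := fun y => congrArg Subtype.val (LinearMap.congr_fun hs y)
  have : Nontrivial R := Submodule.nontrivial_iff_ne_bot.2 hne
  obtain ⟨c, hc⟩ := Module.End.exists_eigenvalue (g' ∘ₗ s : Module.End k R)
  obtain ⟨y, hy⟩ := hc.exists_hasEigenvector
  have h1 : g (s y) = c • f (s y) := by
    rw [hs']
    exact congrArg Subtype.val hy.apply_eq_smul
  have h2 := hk c (s y) (s y).2 h1
  rw [hs'] at h2
  exact hy.2 (Subtype.ext h2)

variable [CharZero k] {r : ℕ}

lemma θ_eq_act (M : GSupMod k (Fin r)) (i : Fin r) : M.θ i = actOf M (Pi.single i 1) := by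
  ext x
  rw [act_apply, Finset.sum_eq_single i]
  · simp
  · intro j _ hj; simp [hj]
  · simp

lemma act_zero_of {M : GSupMod k (Fin r)} (hg : Good M) (h1 : finrank k M.carrier = 1)
    (v : Fin r → k) : actOf M v = 0 := by
  by_cases hv : v = 0
  · ext x; simp [act_apply, hv]
  · have h2 := hg v hv
    rw [nE_add_nO, h1, ← rank_eq] at h2
    rw [← LinearMap.range_eq_bot, ← Submodule.finrank_eq_zero (R := k)]
    omega

lemma θ_zero_of {M : GSupMod k (Fin r)} (hg : Good M) (h1 : finrank k M.carrier = 1)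
    (i : Fin r) : M.θ i = 0 := by rw [θ_eq_act, act_zero_of hg h1]

lemma single_ne (i : Fin r) : (Pi.single i 1 : Fin r → k) ≠ 0 := by
  intro h; simpa using congrFun h i

section two

lemma base_aux [IsAlgClosed k] {M : GSupMod k (Fin 2)} (h0 : ∀ v w x, actOf M v (actOf M w x) = 0)
    (X Y : Submodule k M.carrier) (hX : ∀ v, ∀ x ∈ X, actOf M v x ∈ Y)
    (hY : ∀ v, ∀ x ∈ Y, actOf M v x ∈ X) (c : ℕ)
    (h1 : ∀ v, v ≠ 0 → finrank k (X.map (actOf M v)) = c)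
    (h2 : ∀ v, v ≠ 0 → finrank k (Y.map (actOf M v)) = c)
    (h3 : finrank k X = 2 * c) (h4 : finrank k Y = 2 * c + 1) : c = 0 := by
  set e0 : Fin 2 → k := Pi.single 0 1 with he0
  set e1 : Fin 2 → k := Pi.single 1 1 with he1
  have n0 : e0 ≠ 0 := single_ne 0
  have n1 : e1 ≠ 0 := single_ne 1
  have n2 : ∀ a : k, e1 + (-a) • e0 ≠ 0 := by
    intro a h
    have := congrFun h 1
    simp [he0, he1] at this
  have n3 : ∀ (a : k) x, actOf M e1 x = a • actOf M e0 x → actOf M (e1 + (-a) • e0) x = 0 := by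
    intro a x h
    rw [act_add, LinearMap.add_apply, h]; simp
  have t1 : ∀ v w, v ≠ 0 → w ≠ 0 → Y.map (actOf M v) = X ⊓ LinearMap.ker (actOf M w) := by
    intro v w hv hw
    apply Submodule.eq_of_le_of_finrank_eq
    · rintro _ ⟨x, hx, rfl⟩; exact ⟨hY v x hx, h0 w v x⟩
    · have := finrank_map_add (actOf M w) X
      have := h1 w hw
      have := h2 v hv
      omega
  set R := X.map (actOf M e0) ⊔ X.map (actOf M e1) with hR
  have r1 : ∀ w, R ≤ Y ⊓ LinearMap.ker (actOf M w) := by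
    intro w
    rw [hR, sup_le_iff]
    constructor
    · rintro _ ⟨x, hx, rfl⟩; exact ⟨hX _ x hx, h0 w _ x⟩
    · rintro _ ⟨x, hx, rfl⟩; exact ⟨hX _ x hx, h0 w _ x⟩
  have r2 : ∀ w, w ≠ 0 → finrank k (Y ⊓ LinearMap.ker (actOf M w) : Submodule k M.carrier) = c + 1 := by
    intro w hw
    have := finrank_map_add (actOf M w) Y
    have := h2 w hw
    omega
  have r3 := Submodule.finrank_mono (r1 e0)
  rw [r2 e0 n0] at r3
  have r4 : finrank k (X.map (actOf M e0)) ≤ finrank k R := Submodule.finrank_mono le_sup_left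
  rw [h1 e0 n0] at r4
  rcases Nat.lt_or_ge (finrank k R) (c + 1) with hlt | hge
  · have e : X.map (actOf M e0) = R := Submodule.eq_of_le_of_finrank_eq le_sup_left (by
      rw [h1 e0 n0]; omega)
    have := pencil (actOf M e0) (actOf M e1) X R e le_sup_right (by
      intro a x hx h
      have : x ∈ X ⊓ LinearMap.ker (actOf M (e1 + (-a) • e0)) := ⟨hx, n3 a x h⟩
      rw [← t1 e0 _ n0 (n2 a), t1 e0 e0 n0 n0] at this
      exact this.2)
    rw [← e] at this
    rw [← h1 e0 n0, this, finrank_bot]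
  · have e : ∀ w, w ≠ 0 → R = Y ⊓ LinearMap.ker (actOf M w) := fun w hw =>
      Submodule.eq_of_le_of_finrank_eq (r1 w) (by rw [r2 w hw]; omega)
    have := pencil (actOf M e0) (actOf M e1) Y (Y.map (actOf M e0)) rfl (by
      rw [t1 e1 e0 n1 n0, t1 e0 e0 n0 n0]) (by
      intro a x hx h
      have : x ∈ Y ⊓ LinearMap.ker (actOf M (e1 + (-a) • e0)) := ⟨hx, n3 a x h⟩
      rw [← e _ (n2 a), e e0 n0] at this
      exact this.2)
    rw [← h2 e0 n0, this, finrank_bot]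

lemma base_two [IsAlgClosed k] {M : GSupMod k (Fin 2)} (hM : VCat k 2 M) (hg : Good M)
    (hab : ∀ v, v ≠ 0 → na M v = nb M v) (ht : ∀ x, tp M x = 0) : finrank k M.carrier = 1 := by
  have t01 : ∀ x, M.θ 0 (M.θ 1 x) = 0 := fun x => by
    have := ht x
    simpa [tp, List.finRange_succ] using this
  have tt : ∀ i j x, M.θ i (M.θ j x) = 0 := by
    intro i j x
    fin_cases i <;> fin_cases j
    · exact sq0 hM _ _
    · exact t01 x
    · have := ac hM 1 0 x
      rw [t01, neg_zero] at this
      exact this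
    · exact sq0 hM _ _
  have h0 : ∀ v w x, actOf M v (actOf M w x) = 0 := by
    intro v w x
    simp [act_apply, tt]
  have n0 : (Pi.single 0 1 : Fin 2 → k) ≠ 0 := single_ne 0
  have hc : na M (Pi.single 0 1) = 0 := by
    have g0 := hg _ n0
    have g1 := hab _ n0
    have g2 := ab_le_E hM (Pi.single 0 1)
    have g3 := ab_le_O hM (Pi.single 0 1)
    have a1 : ∀ v, v ≠ 0 → na M v = na M (Pi.single 0 1) := fun v hv => na_const hg v _ hv n0
    have a2 : ∀ v, v ≠ 0 → nb M v = na M (Pi.single 0 1) := fun v hv => by rw [← hab v hv, a1 v hv]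
    rcases (by omega : nE M = 2 * na M (Pi.single 0 1) ∧ nO M = 2 * na M (Pi.single 0 1) + 1 ∨
      nO M = 2 * na M (Pi.single 0 1) ∧ nE M = 2 * na M (Pi.single 0 1) + 1) with ⟨h3, h4⟩ | ⟨h3, h4⟩
    · exact base_aux h0 M.ev M.od (fun v x => act_ev M v) (fun v x => act_od M v) _ a1 a2 h3 h4
    · exact base_aux h0 M.od M.ev (fun v x => act_od M v) (fun v x => act_ev M v) _ a2 a1 h3 h4
  have g0 := hg _ n0
  have g1 := hab _ n0
  rw [nE_add_nO] at g0
  omega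
end two

section step

lemma anti_pl (M : GSupMod k (Fin r)) (D : M.carrier →ₗ[k] M.carrier) (l : List (Fin r))
    (h : ∀ i ∈ l, ∀ x, D (M.θ i x) = - M.θ i (D x)) :
    ∃ c : k, ∀ x, D (pl M l x) = pl M l (c • D x) := by
  induction l with
  | nil => exact ⟨1, fun x => by simp⟩
  | cons i l ih =>
    obtain ⟨c, hc⟩ := ih fun j hj => h j (List.mem_cons_of_mem _ hj)
    refine ⟨-c, fun x => ?_⟩
    rw [pl_cons, pl_cons, h i List.mem_cons_self, hc, neg_smul, map_neg, map_neg]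

/-- restriction along a family of vectors -/
def restr {s : ℕ} (M : GSupMod k (Fin r)) (ε : Fin s → Fin r → k) : GSupMod k (Fin s) where
  carrier := M.carrier
  ev := M.ev
  od := M.od
  isCompl := M.isCompl
  θ := fun j => actOf M (ε j)
  θ_ev := fun _ _ hx => act_ev M _ hx
  θ_od := fun _ _ hx => act_od M _ hx

lemma restr_vcat {s : ℕ} {M : GSupMod k (Fin r)} (hM : VCat k r M) (ε : Fin s → Fin r → k) :
    VCat k s (restr M ε) := vcat_of fun i j x => act_act hM (ε i) (ε j) x

lemma restr_act {s : ℕ} (M : GSupMod k (Fin r)) (ε : Fin s → Fin r → k) (v : Fin s → k) :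
    actOf (restr M ε) v = actOf M (fun i => ∑ j, v j * ε j i) := by
  have key : ∀ x : M.carrier, ∑ j, v j • actOf M (ε j) x = actOf M (fun i => ∑ j, v j * ε j i) x := by
    intro x
    simp only [act_apply, Finset.smul_sum, Finset.sum_smul, smul_smul]
    rw [Finset.sum_comm]
  exact LinearMap.ext fun x => (act_apply (restr M ε) v x).trans (key x)

/-- the inductive claim -/
def QQ (k : Type) [Field k] (r : ℕ) : Prop := ∀ M : GSupMod k (Fin r), VCat k r M → Good M →
    (∀ v, v ≠ 0 → na M v = nb M v) → (∀ x, tp M x = 0) → finrank k M.carrier = 1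

/-- vectors for restriction -/
def eps {n : ℕ} (a b : k) : Fin (n + 2) → Fin (n + 3) → k :=
  Fin.cons (Pi.single 0 a + Pi.single 1 b) (fun j => Pi.single j.succ.succ 1)

lemma eps_ne {n : ℕ} (a b : k) (hab : a ≠ 0 ∨ b ≠ 0) (v : Fin (n + 2) → k) (hv : v ≠ 0) :
    (fun i : Fin (n + 3) => ∑ j, v j * eps a b j i) ≠ 0 := by
  intro h
  apply hv
  have key : ∀ i, ∑ j, v j * eps a b j i = 0 := fun i => congrFun h i
  have k0 := key 0
  have k1 := key 1
  rw [Fin.sum_univ_succ] at k0 k1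
  have z0 : ∀ j : Fin (n+1), (Pi.single j.succ.succ 1 : Fin (n+3) → k) 0 = 0 := fun j =>
    Pi.single_eq_of_ne (Fin.succ_ne_zero _).symm 1
  have z1 : ∀ j : Fin (n+1), (Pi.single j.succ.succ 1 : Fin (n+3) → k) 1 = 0 := fun j =>
    Pi.single_eq_of_ne (by rw [← Fin.succ_zero_eq_one]; exact fun h => Fin.succ_ne_zero j (Fin.succ_injective _ h).symm) 1
  simp only [eps, Fin.cons_zero, Fin.cons_succ, z0, z1, mul_zero, Finset.sum_const_zero, add_zero] at k0 k1
  have w0 : v 0 = 0 := by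
    rcases hab with h | h
    · simpa [h] using k0
    · simpa [h] using k1
  funext j
  refine Fin.cases w0 (fun j => ?_) j
  have kj := key j.succ.succ
  rw [Fin.sum_univ_succ, w0, zero_mul, zero_add, Finset.sum_eq_single j] at kj
  · simpa [eps] using kj
  · intro i _ hi
    simp only [eps, Fin.cons_succ]
    rw [Pi.single_eq_of_ne, mul_zero]
    exact fun h => hi (Fin.succ_injective _ (Fin.succ_injective _ h)).symm
  · simp

lemma ker_aux {n : ℕ} {R C F : GSupMod k (Fin (n + 2))} (hd : IsDsum C F R)
    (hF : Cliff F) (hC : ∀ i, C.θ i = 0) (x : R.carrier)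
    (hx : R.θ 0 (pl R ((List.finRange (n + 1)).map Fin.succ) x) = 0) :
    ∃ y, pl R ((List.finRange (n + 1)).map Fin.succ) x =
      R.θ 0 (pl R ((List.finRange (n + 1)).map Fin.succ) y) := by
  set L : List (Fin (n + 2)) := (List.finRange (n + 1)).map Fin.succ with hL
  obtain ⟨iA, iB, pA, pB, hiA, hiB, hpA, hpB, e1, e2, e3, e4, e5⟩ := isDsum_maps hd
  obtain ⟨d, d1, d2, d3⟩ := cliff_d hF
  have hB := (isHom_iff _ _ _).1 hpB
  have hiB' := (isHom_iff _ _ _).1 hiB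
  obtain ⟨c, hc⟩ := anti_pl F (d 0) L (by
    intro i hi y
    apply d2
    rw [hL, List.mem_map] at hi
    obtain ⟨j, -, rfl⟩ := hi
    exact (Fin.succ_ne_zero j).symm)
  have hz : pA (pl R L x) = 0 := by
    rw [hom_pl hpA, hL, List.finRange_succ, List.map_cons, pl_cons, hC, LinearMap.zero_apply]
  have hu : F.θ 0 (pl F L (pB x)) = 0 := by
    rw [← hom_pl hpB, ← hB.1, hx, map_zero]
  have h2 : pl F L (pB x) = F.θ 0 (pl F L (c • d 0 (pB x))) := by
    have := d1 0 (pl F L (pB x))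
    rw [hu, map_zero, eq_comm, sub_eq_zero, hc] at this
    exact this
  refine ⟨iB (c • d 0 (pB x)), ?_⟩
  have h3 : pl R L x = iB (pB (pl R L x)) := by
    have := e5 (pl R L x)
    rw [hz, map_zero, zero_add] at this
    exact this.symm
  rw [h3, hom_pl hpB, h2, hiB'.1, hom_pl hiB]

lemma step_dec {n : ℕ} (ih : QQ k (n + 2)) {M : GSupMod k (Fin (n + 3))} (hM : VCat k _ M)
    (hg : Good M) (hab : ∀ v, v ≠ 0 → na M v = nb M v) (a b : k) (h : a ≠ 0 ∨ b ≠ 0) :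
    ∃ C F, IsDsum C F (restr M (eps a b)) ∧ Cliff F ∧ VCat k (n + 2) F ∧ finrank k C.carrier = 1 ∧
      ∀ i, C.θ i = 0 := by
  have hR := restr_vcat hM (eps a b)
  obtain ⟨C, F, hd, hF, vF, vC, ht⟩ := decompose hR
  obtain ⟨n1, n2, n3⟩ := dsum_num hd
  have q : ∀ v, v ≠ 0 → nE C + nO C = 2 * (na C v + nb C v) + 1 ∧ na C v = nb C v := by
    intro v hv
    have g1 := hg _ (eps_ne a b h v hv)
    have g2 := hab _ (eps_ne a b h v hv)
    have c1 := cliff_num vF hF v hv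
    have c2 := cliff_ab vF hF (by omega) v hv
    have m1 := n3 v
    have x1 : nE (restr M (eps a b)) = nE M := rfl
    have x2 : nO (restr M (eps a b)) = nO M := rfl
    have x3 : na (restr M (eps a b)) v = na M (fun i => ∑ j, v j * eps a b j i) := by
      rw [na, restr_act]; rfl
    have x4 : nb (restr M (eps a b)) v = nb M (fun i => ∑ j, v j * eps a b j i) := by
      rw [nb, restr_act]; rfl
    omega
  have gC : Good C := fun v hv => (q v hv).1
  have h1 := ih C vC gC (fun v hv => (q v hv).2) ht
  exact ⟨C, F, hd, hF, vF, h1, θ_zero_of gC h1⟩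

lemma restr_zero {n : ℕ} (M : GSupMod k (Fin (n + 3))) (a b : k) (x : M.carrier) :
    (restr M (eps a b)).θ 0 x = a • M.θ 0 x + b • M.θ 1 x := by
  have h : eps a b 0 = a • (Pi.single 0 1 : Fin (n + 3) → k) + b • Pi.single 1 1 := by
    funext i
    simp [eps, Pi.single_apply]
  show actOf M (eps a b 0) x = _
  rw [h, act_add, θ_eq_act, θ_eq_act, LinearMap.add_apply, LinearMap.smul_apply]
  congr 1
  simp only [act_apply, Finset.smul_sum, smul_smul, Pi.smul_apply, smul_eq_mul]

lemma restr_pl {n : ℕ} (M : GSupMod k (Fin (n + 3))) (a b : k) (l : List (Fin (n + 1))) (x : M.carrier) :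
    pl (restr M (eps a b)) (l.map Fin.succ) x = pl M (l.map fun j => j.succ.succ) x := by
  induction l with
  | nil => rfl
  | cons j l ih =>
    rw [List.map_cons, List.map_cons]
    refine (pl_cons _ _ _ _).trans ?_
    rw [ih, pl_cons, θ_eq_act M]
    rfl

lemma step_QQ [IsAlgClosed k] {n : ℕ} (ih : QQ k (n + 2)) : QQ k (n + 3) := by
  intro M hM hg hab ht
  set L : List (Fin (n + 3)) := (List.finRange (n + 1)).map fun j => j.succ.succ with hL
  have ht' : ∀ x, M.θ 0 (M.θ 1 (pl M L x)) = 0 := by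
    intro x
    have := ht x
    rw [tp, List.finRange_succ, List.finRange_succ, List.map_cons, pl_cons, pl_cons, List.map_map] at this
    exact this
  have ht2 : ∀ x, M.θ 1 (M.θ 0 (pl M L x)) = 0 := by
    intro x
    rw [ac hM, ht', neg_zero]
  have k1 : ∀ a b : k, a ≠ 0 ∨ b ≠ 0 → ∀ x, a • M.θ 0 (pl M L x) + b • M.θ 1 (pl M L x) = 0 →
      ∃ y, pl M L x = a • M.θ 0 (pl M L y) + b • M.θ 1 (pl M L y) := by
    intro a b h x hx
    obtain ⟨C, F, hd, hF, vF, -, hC⟩ := step_dec ih hM hg hab a b h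
    obtain ⟨y, hy⟩ := ker_aux hd hF hC x (by
      rw [restr_pl, restr_zero]; exact hx)
    have y1 := restr_pl M a b (List.finRange (n + 1)) x
    have y2 := restr_pl M a b (List.finRange (n + 1)) y
    have y3 := restr_zero M a b (pl M L y)
    refine ⟨y, y1.symm.trans (hy.trans (Eq.trans ?_ y3))⟩
    exact congrArg _ y2
  have comm : ∀ i : Fin (n + 3), i ∉ L → ∀ x, ∃ y, M.θ i (pl M L x) = pl M L y := by
    intro i hi x
    obtain ⟨c, hc⟩ := anti_pl M (M.θ i) L (fun j _ x => ac hM i j x)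
    exact ⟨_, hc x⟩
  let U := LinearMap.range (pl M L)
  have hU0 : ∀ x, M.θ 0 (pl M L x) = 0 := by
    have := pencil (M.θ 0) (M.θ 1) U (U.map (M.θ 0)) rfl ?_ ?_
    · intro x
      have h2 : M.θ 0 (pl M L x) ∈ U.map (M.θ 0) := ⟨_, ⟨x, rfl⟩, rfl⟩
      rw [this] at h2
      exact h2
    · rintro _ ⟨_, ⟨x, rfl⟩, rfl⟩
      obtain ⟨c, hc⟩ := anti_pl M (M.θ 1) L (fun j _ x => ac hM 1 j x)
      obtain ⟨y, hy⟩ := k1 1 0 (Or.inl one_ne_zero) (c • M.θ 1 x) (by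
        rw [← hc, ht', smul_zero, zero_smul, zero_add])
      rw [hc, hy]
      exact ⟨_, ⟨y, rfl⟩, by simp⟩
    · rintro c _ ⟨x, rfl⟩ h
      obtain ⟨y, hy⟩ := k1 (-c) 1 (Or.inr one_ne_zero) x (by rw [h]; simp)
      rw [hy, map_add, map_smul, map_smul, ht', sq0 hM]; simp
  have hUz : ∀ x, pl M L x = 0 := by
    intro x
    obtain ⟨y, hy⟩ := k1 1 0 (Or.inl one_ne_zero) x (by rw [hU0]; simp)
    rw [hy, hU0]; simp
  obtain ⟨C, F, hd, hF, vF, h1, hC⟩ := step_dec ih hM hg hab 1 0 (Or.inl one_ne_zero)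
  obtain ⟨iA, iB, pA, pB, hiA, hiB, hpA, hpB, e1, e2, e3, e4, e5⟩ := isDsum_maps hd
  have hz : ∀ z : F.carrier, z = 0 := cliff_zero vF hF ((List.finRange (n + 1)).map Fin.succ)
    ((List.nodup_finRange _).map (Fin.succ_injective _)) (by
      intro z
      have h3 := hom_pl hiB ((List.finRange (n + 1)).map Fin.succ) z
      have h4 := restr_pl M 1 0 (List.finRange (n + 1)) (iB z)
      rw [← hL] at h4
      rw [h4] at h3
      have h5 : iB (pl F ((List.finRange (n + 1)).map Fin.succ) z) = 0 := h3.trans (hUz _)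
      rw [← e2 (pl F _ z), h5, map_zero])
  have e : C.carrier ≃ₗ[k] (restr M (eps 1 0)).carrier := LinearEquiv.ofBijective iA
    ⟨Function.LeftInverse.injective e1, fun x => ⟨pA x, by
      have := e5 x
      rw [hz (pB x), map_zero, add_zero] at this
      exact this⟩⟩
  rw [← h1]
  exact e.finrank_eq.symm

lemma all_QQ [IsAlgClosed k] : ∀ n, QQ k (n + 2)
  | 0 => fun _ h1 h2 h3 h4 => base_two h1 h2 h3 h4
  | n + 1 => step_QQ (all_QQ n)

end step

end SupCat.EP

end

noncomputable section
set_option linter.unusedSectionVars false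
namespace SupCat.EP
open SupCat SupCat.GSupMod
open Module (finrank)
variable {k : Type} [Field k] [CharZero k] {r : ℕ}

/-- the numerical index -/
def Idx (M : GSupMod k (Fin r)) (m : ℤ) : Prop := Good M ∧ ∀ v, v ≠ 0 →
  ((nE M = nO M + 1 ∧ (na M v : ℤ) - nb M v = m) ∨ (nO M = nE M + 1 ∧ (nb M v : ℤ) - na M v = m))

lemma syz_idx1 {A B : GSupMod k (Fin r)} (h : Syz A B) (hr : 2 ≤ r) {m : ℤ} (hB : Idx B m) :
    Idx A (m - 1) := by
  constructor
  · intro v hv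
    obtain ⟨c, h1, h2, h3, h4⟩ := syz_num h hr v hv
    have := hB.1 v hv
    omega
  · intro v hv
    obtain ⟨c, h1, h2, h3, h4⟩ := syz_num h hr v hv
    have := hB.2 v hv
    omega

lemma syz_idx2 {A B : GSupMod k (Fin r)} (h : Syz A B) (hr : 2 ≤ r) {m : ℤ} (hA : Idx A m) :
    Idx B (m + 1) := by
  constructor
  · intro v hv
    obtain ⟨c, h1, h2, h3, h4⟩ := syz_num h hr v hv
    have := hA.1 v hv
    omega
  · intro v hv
    obtain ⟨c, h1, h2, h3, h4⟩ := syz_num h hr v hv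
    have := hA.2 v hv
    omega

lemma exists_idx {M : GSupMod k (Fin r)} (hM : VCat k r M) (hg : Good M) (hr : 1 ≤ r) :
    ∃ m, Idx M m := by
  obtain ⟨w, hw⟩ : ∃ w : Fin r → k, w ≠ 0 := ⟨_, single_ne ⟨0, hr⟩⟩
  have g1 := hg w hw
  have g2 := ab_le_E hM w
  have g3 := ab_le_O hM w
  rcases (by omega : nE M = nO M + 1 ∨ nO M = nE M + 1) with h | h
  · refine ⟨(na M w : ℤ) - nb M w, hg, fun v hv => Or.inl ⟨h, ?_⟩⟩
    have := na_const hg v w hv hw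
    have := hg v hv
    omega
  · refine ⟨(nb M w : ℤ) - na M w, hg, fun v hv => Or.inr ⟨h, ?_⟩⟩
    have := na_const hg v w hv hw
    have := hg v hv
    omega

/-- a zero object -/
def zob (k : Type) [Field k] (r : ℕ) : GSupMod k (Fin r) where
  carrier := PUnit
  ev := ⊤
  od := ⊥
  isCompl := isCompl_top_bot
  θ := fun _ => 0
  θ_ev := fun _ _ _ => Submodule.zero_mem _
  θ_od := fun _ _ _ => Submodule.zero_mem _

lemma zob_zero (x : (zob k r).carrier) : x = 0 := rfl

lemma zob_proj : IsProjective (VCat k r) (zob k r) :=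
  cliff_projective (vcat_of fun _ _ _ => rfl) ⟨fun _ => 0, fun _ _ => ⟨fun _ _ => rfl, fun _ => rfl⟩⟩

lemma zob_hom (M : GSupMod k (Fin r)) : IsHom (zob k r) M 0 :=
  ⟨fun i => by ext; simp, fun _ _ => Submodule.zero_mem _, fun _ _ => Submodule.zero_mem _⟩

lemma dsum_zob_right (M : GSupMod k (Fin r)) : IsDsum M (zob k r) M := by
  refine isDsum_of_maps (isHom_id M) (zob_hom M) Function.injective_id (fun _ _ _ => rfl) ?_
  rw [LinearMap.range_id, LinearMap.range_zero]
  exact isCompl_top_bot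

lemma dsum_zob_left (M : GSupMod k (Fin r)) : IsDsum (zob k r) M M := by
  refine isDsum_of_maps (zob_hom M) (isHom_id M) (fun _ _ _ => rfl) Function.injective_id ?_
  rw [LinearMap.range_id, LinearMap.range_zero]
  exact isCompl_bot_top

lemma triv_of {C : GSupMod k (Fin r)} (h1 : finrank k C.carrier = 1)
    (h0 : ∀ i, C.θ i = 0) : ∃ p, IsTrivial p C := by
  have h := nE_add_nO C
  rw [h1] at h
  rcases (by omega : nE C = 1 ∨ nO C = 1) with h2 | h2
  · refine ⟨false, h1, h0, ?_⟩
    simp only [Bool.false_eq_true, if_false]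
    exact Submodule.eq_top_of_finrank_eq (by rw [h1]; exact h2)
  · refine ⟨true, h1, h0, ?_⟩
    simp only [if_true]
    exact Submodule.eq_top_of_finrank_eq (by rw [h1]; exact h2)

lemma omega_zero_of (hr : 1 ≤ r) {C : GSupMod k (Fin r)}
    (h0 : ∀ i, C.θ i = 0) : IsOmegaZero (VCat k r) C C := by
  refine ⟨zob k r, zob_proj, fun A B hA hd a => ?_, dsum_zob_right C⟩
  obtain ⟨iA, iB, pA, pB, hiA, hiB, hpA, hpB, e1, e2, e3, e4, e5⟩ := isDsum_maps hd
  obtain ⟨d, d1, d2, d3⟩ := cliff_d (projective_cliff hA)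
  have hz : ∀ i x, A.θ i x = 0 := by
    intro i x
    rw [← e1 (A.θ i x), ((isHom_iff _ _ _).1 hiA).1, h0, LinearMap.zero_apply, map_zero]
  have := d1 ⟨0, hr⟩ a
  rw [hz, hz, map_zero, sub_zero] at this
  exact this.symm

variable [IsAlgClosed k]

lemma idx_zero (hr : 2 ≤ r) {C : GSupMod k (Fin r)} (hC : VCat k r C) (ht : ∀ x, tp C x = 0)
    (h : Idx C 0) : ∃ p K, IsTrivial p K ∧ IsOmegaZero (VCat k r) K C := by
  obtain ⟨n, rfl⟩ : ∃ n, r = n + 2 := ⟨r - 2, by omega⟩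
  have h1 := all_QQ n C hC h.1 (fun v hv => by have := h.2 v hv; omega) ht
  have h0 := θ_zero_of h.1 h1
  obtain ⟨p, hp⟩ := triv_of h1 h0
  exact ⟨p, C, hp, omega_zero_of (by omega) h0⟩

lemma idx_pos (hr : 2 ≤ r) (m : ℕ) : ∀ C : GSupMod k (Fin r), VCat k r C → (∀ x, tp C x = 0) →
    Idx C m → ∃ p K, IsTrivial p K ∧ IsOmegaPow (VCat k r) m K C := by
  induction m with
  | zero => exact fun C hC ht h => idx_zero hr hC ht h
  | succ m ih =>
    intro C hC ht h
    obtain ⟨A, hA, vA, tA⟩ := exists_cosyz hC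
    obtain ⟨p, K, hK, ho⟩ := ih A vA tA (by simpa using syz_idx1 hA hr h)
    exact ⟨p, K, hK, A, ho, syz_isSyzygy hA tA ht⟩

lemma idx_neg (hr : 2 ≤ r) (m : ℕ) : ∀ C : GSupMod k (Fin r), VCat k r C → (∀ x, tp C x = 0) →
    Idx C (-m) → ∃ p K, IsTrivial p K ∧ IsOmegaNegPow (VCat k r) m K C := by
  induction m with
  | zero => exact fun C hC ht h => idx_zero hr hC ht (by simpa using h)
  | succ m ih =>
    intro C hC ht h
    obtain ⟨A, hA, vA, tA⟩ := exists_syz hC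
    obtain ⟨p, K, hK, ho⟩ := ih A vA tA (by simpa using syz_idx2 hA hr h)
    exact ⟨p, K, hK, A, ho, syz_isCosyzygy hA ht tA⟩

lemma idx_omega (hr : 2 ≤ r) (m : ℤ) (C : GSupMod k (Fin r)) (hC : VCat k r C) (ht : ∀ x, tp C x = 0)
    (h : Idx C m) : ∃ p K, IsTrivial p K ∧ IsOmega (VCat k r) m K C := by
  unfold IsOmega
  split_ifs with hm
  · exact idx_pos hr _ C hC ht (by rw [Int.toNat_of_nonneg hm]; exact h)
  · exact idx_neg hr _ C hC ht (by rw [Int.toNat_of_nonneg (by omega), neg_neg]; exact h)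

lemma main_thm (M : GSupMod k (Fin r)) (hM : VCat k r M)
    (hE : IsEndotrivial (VCat k r) M) :
    ∃ (n : ℤ) (p : Bool) (K N P : GSupMod k (Fin r)),
      IsTrivial p K ∧ IsOmega (VCat k r) n K N ∧
      IsProjective (VCat k r) P ∧ IsDsum N P M := by
  rcases Nat.eq_zero_or_pos r with rfl | hr
  · have hpr : ∀ A : GSupMod k (Fin 0), IsProjective (VCat k 0) A := fun A =>
      cliff_projective (fun i => i.elim0) ⟨fun i => i.elim0, fun i => i.elim0⟩
    let K : GSupMod k (Fin 0) :=
      { carrier := k, ev := ⊤, od := ⊥, isCompl := isCompl_top_bot, θ := fun _ => 0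
        θ_ev := fun i => i.elim0, θ_od := fun i => i.elim0 }
    refine ⟨0, false, K, zob k 0, M, ⟨Module.finrank_self k, fun i => i.elim0, by simp [K]⟩, ?_, hpr M, dsum_zob_left M⟩
    rw [IsOmega, if_pos le_rfl]
    refine ⟨K, hpr K, fun A B hA hd a => ?_, dsum_zob_left K⟩
    obtain ⟨iA, iB, pA, pB, hiA, hiB, hpA, hpB, e1, -⟩ := isDsum_maps hd
    rw [← e1 a, zob_zero (iA a), map_zero]
  have hg := good_of_endo hE
  obtain ⟨C, F, hd, hF, vF, vC, ht⟩ := decompose hM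
  obtain ⟨n1, n2, n3⟩ := dsum_num hd
  have gC : Good C := by
    intro v hv
    have g1 := hg v hv
    have c1 := cliff_num vF hF v hv
    have m1 := n3 v
    omega
  have pF := cliff_projective vF hF
  rcases (by omega : r = 1 ∨ 2 ≤ r) with rfl | hr2
  · have h0 : ∀ i, C.θ i = 0 := by
      intro i
      ext x
      have := ht x
      rw [Subsingleton.elim i 0]
      simpa [tp, List.finRange_succ] using this
    have h1 : finrank k C.carrier = 1 := by
      rw [← nE_add_nO, gC _ (single_ne 0), ← rank_eq, ← θ_eq_act, h0, LinearMap.range_zero, finrank_bot]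
    obtain ⟨p, hp⟩ := triv_of h1 h0
    refine ⟨0, p, C, C, F, hp, ?_, pF, hd⟩
    rw [IsOmega, if_pos le_rfl]
    exact omega_zero_of le_rfl h0
  · obtain ⟨m, hm⟩ := exists_idx vC gC hr
    obtain ⟨p, K, hK, ho⟩ := idx_omega hr2 m C vC ht hm
    exact ⟨m, p, K, C, F, hK, ho, pF, hd⟩

end SupCat.EP

end

open SupCat SupCat.GSupMod in
/-- Let `M` be an endotrivial `V(a_r)`-supermodule, where
`a_r` is a rank `r` detecting subalgebra (so `V(a_r) = Λ((a_r)₁)`).  Then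
`M ≅ Ωⁿ(k) ⊕ P` for some integer `n`, where `k` is either the trivial module
`k_ev` or its parity shift `k_od`, and `P` is a projective module in `F`. -/
theorem endotrivial_VMod_is_syzygy_of_trivial
    (k : Type) [Field k] [IsAlgClosed k] [CharZero k] (r : ℕ)
    (M : GSupMod k (Fin r)) (hM : VCat k r M)
    (hE : IsEndotrivial (VCat k r) M) :
    ∃ (n : ℤ) (p : Bool) (K N P : GSupMod k (Fin r)),
      IsTrivial p K ∧ IsOmega (VCat k r) n K N ∧
      IsProjective (VCat k r) P ∧ IsDsum N P M := by
  exact SupCat.EP.main_thm M hM hE
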